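/- Let k be an algebraically closed field of characteristic zero, n ≥ 4, d ≥ 1, and a, b, c ∈ ℕ with a + b ≤ d − 1. Set t = ⌊C(d+n,n)/(d+1)⌋ and t* = ⌈C(d+n,n)/(d+1)⌉. If c ≤ t − 2(a+b), then there exist in P^n sundials Ĉ_1,…,Ĉ_a, degenerate conics D_1,…,D_b, points R_1,…,R_b and lines M_1,…,M_c whose combined ideal I satisfies dim (I)_d = C(d+n,n) − (2a + 2b + c)(d+1). If instead c ≥ t* − 2(a+b), then for such a configuration with c lines one can achieve dim (I)_d = 0. -/

import Mathlib

open MvPolynomial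

noncomputable def vanIdeal (k : Type) [Field k] (N : ℕ) (V : Set (Fin N → k)) :
    Ideal (MvPolynomial (Fin N) k) where
  carrier := {f | ∀ v ∈ V, MvPolynomial.eval v f = 0}
  add_mem' := by
    intro f g hf hg v hv
    simp only [Set.mem_setOf_eq] at *
    simp [map_add, hf v hv, hg v hv]
  zero_mem' := by
    intro v hv
    simp
  smul_mem' := by
    intro c f hf v hv
    simp only [Set.mem_setOf_eq] at *
    simp [smul_eq_mul, hf v hv]

noncomputable def hdim (k : Type) [Field k] (N : ℕ)
    (I : Ideal (MvPolynomial (Fin N) k)) (d : ℕ) : ℕ :=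
  Module.finrank k
    ↥(Submodule.restrictScalars k
        (I : Submodule (MvPolynomial (Fin N) k) (MvPolynomial (Fin N) k))
      ⊓ MvPolynomial.homogeneousSubmodule (Fin N) k d)

/-- A 3-dimensional sundial: two distinct lines `V₁ ≠ V₂` meeting in a point
`P = V₁ ⊓ V₂`, together with a 4-dimensional subspace `T ⊇ V₁ ⊔ V₂`. -/
def IsSundial (k : Type) [Field k] (N : ℕ)
    (V₁ V₂ T : Submodule k (Fin N → k)) : Prop :=
  Module.finrank k V₁ = 2 ∧ Module.finrank k V₂ = 2 ∧ V₁ ≠ V₂ ∧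
    Module.finrank k ↥(V₁ ⊓ V₂) = 1 ∧ V₁ ⊔ V₂ ≤ T ∧ Module.finrank k T = 4

/-- The ideal `I(V₁) ∩ I(V₂) ∩ (I(P)² + I(T))` of a 3-dimensional sundial. -/
noncomputable def sundialIdeal (k : Type) [Field k] (N : ℕ)
    (V₁ V₂ T : Submodule k (Fin N → k)) : Ideal (MvPolynomial (Fin N) k) :=
  vanIdeal k N ↑V₁ ⊓ vanIdeal k N ↑V₂ ⊓
    ((vanIdeal k N ↑(V₁ ⊓ V₂)) ^ 2 + vanIdeal k N ↑T)


namespace S15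
section PartA
variable {k : Type} [Field k]

/-- functions of one parameter given by a polynomial -/
def PolyFn (g : k → k) : Prop := ∃ p : Polynomial k, ∀ e, g e = p.eval e

lemma PolyFn.const (c : k) : PolyFn (fun _ : k => c) := ⟨Polynomial.C c, by simp⟩
lemma PolyFn.id' : PolyFn (fun e : k => e) := ⟨Polynomial.X, by simp⟩
lemma PolyFn.add {f g : k → k} (hf : PolyFn f) (hg : PolyFn g) : PolyFn (fun e => f e + g e) := by
  obtain ⟨p, hp⟩ := hf
  obtain ⟨q, hq⟩ := hg
  exact ⟨p + q, by simp [hp, hq]⟩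
lemma PolyFn.mul {f g : k → k} (hf : PolyFn f) (hg : PolyFn g) : PolyFn (fun e => f e * g e) := by
  obtain ⟨p, hp⟩ := hf
  obtain ⟨q, hq⟩ := hg
  exact ⟨p * q, by simp [hp, hq]⟩
lemma PolyFn.sub {f g : k → k} (hf : PolyFn f) (hg : PolyFn g) : PolyFn (fun e => f e - g e) := by
  obtain ⟨p, hp⟩ := hf
  obtain ⟨q, hq⟩ := hg
  exact ⟨p - q, by simp [hp, hq]⟩
lemma PolyFn.affine (a b : k) : PolyFn (fun e : k => a + e * b) :=
  (PolyFn.const a).add (PolyFn.id'.mul (PolyFn.const b))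
lemma PolyFn.sum {ι : Type*} (s : Finset ι) {f : ι → k → k} (hf : ∀ i ∈ s, PolyFn (f i)) :
    PolyFn (fun e => ∑ i ∈ s, f i e) := by
  classical
  choose! p hp using hf
  refine ⟨∑ i ∈ s, p i, fun e => ?_⟩
  rw [Polynomial.eval_finsetSum]
  exact Finset.sum_congr rfl (fun i hi => hp i hi e)
lemma PolyFn.prod {ι : Type*} (s : Finset ι) {f : ι → k → k} (hf : ∀ i ∈ s, PolyFn (f i)) :
    PolyFn (fun e => ∏ i ∈ s, f i e) := by
  classical
  choose! p hp using hf
  refine ⟨∏ i ∈ s, p i, fun e => ?_⟩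
  rw [Polynomial.eval_prod]
  exact Finset.prod_congr rfl (fun i hi => hp i hi e)
lemma PolyFn.pow {f : k → k} (hf : PolyFn f) (n : ℕ) : PolyFn (fun e => f e ^ n) := by
  obtain ⟨p, hp⟩ := hf
  exact ⟨p ^ n, by simp [hp]⟩
lemma PolyFn.mvEval {σ : Type*} {v : k → σ → k} (hv : ∀ i, PolyFn (fun e => v e i))
    (f : MvPolynomial σ k) : PolyFn (fun e => eval (v e) f) := by
  choose p hp using hv
  refine ⟨aeval p f, fun e => ?_⟩
  have h : (Polynomial.evalRingHom e) (aeval p f) = eval (v e) f := by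
    rw [MvPolynomial.aeval_def, MvPolynomial.hom_eval₂]
    rw [show v e = fun i => (p i).eval e from funext fun i => hp i e]
    simp only [eval, coe_eval₂Hom]
    congr 1
    ext x
    simp
  exact h.symm
lemma PolyFn.det {n : Type*} [Fintype n] [DecidableEq n] {A : k → Matrix n n k}
    (hA : ∀ i j, PolyFn (fun e => A e i j)) : PolyFn (fun e => (A e).det) := by
  simp only [Matrix.det_apply']
  exact PolyFn.sum _ fun σ _ => (PolyFn.const _).mul (PolyFn.prod _ fun i _ => hA _ _)

lemma PolyFn.finite_zero {g : k → k} (hg : PolyFn g) {e0 : k} (h : g e0 ≠ 0) :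
    {e | g e = 0}.Finite := by
  obtain ⟨p, hp⟩ := hg
  have hp0 : p ≠ 0 := by
    rintro rfl
    simp [hp] at h
  refine (p.rootSet_finite k).subset fun e he => ?_
  simp only [Set.mem_ofPred_eq, hp] at he
  simp [Polynomial.mem_rootSet, hp0, he]

/-- sets meeting every line in the empty set or in a cofinite set -/
def LineOpen {E : Type*} [AddCommGroup E] [Module k E] (U : Set E) : Prop :=
  ∀ p v : E, ∀ e0 : k, p + e0 • v ∈ U → {e : k | p + e • v ∉ U}.Finite

section
variable {E : Type*} [AddCommGroup E] [Module k E]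

lemma LineOpen.inter {U V : Set E} (hU : LineOpen (k := k) U) (hV : LineOpen (k := k) V) :
    LineOpen (k := k) (U ∩ V) := by
  intro p v e0 h
  refine ((hU p v e0 h.1).union (hV p v e0 h.2)).subset fun e he => ?_
  simp only [Set.mem_ofPred_eq, Set.mem_inter_iff, Set.mem_union] at *
  tauto

lemma LineOpen.inter_nonempty [Infinite k] {U V : Set E} (hU : LineOpen (k := k) U)
    (hV : LineOpen (k := k) V) (nU : U.Nonempty) (nV : V.Nonempty) : (U ∩ V).Nonempty := by
  obtain ⟨p, hp⟩ := nU
  obtain ⟨q, hq⟩ := nV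
  have h1 := hU p (q - p) 0 (by simpa using hp)
  have h2 := hV p (q - p) 1 (by simpa using hq)
  obtain ⟨e, he⟩ := (h1.union h2).exists_notMem
  refine ⟨p + e • (q - p), ?_⟩
  simp only [Set.mem_ofPred_eq, Set.mem_union, not_or, not_not] at he
  exact he

lemma LineOpen.preimage {F : Type*} [AddCommGroup F] [Module k F] {U : Set F}
    (hU : LineOpen (k := k) U) (l : E →ₗ[k] F) : LineOpen (k := k) (l ⁻¹' U) := by
  intro p v e0 h
  have := hU (l p) (l v) e0 (by simpa using h)
  simpa using this

lemma lineOpen_ne (F : E → k) (hF : ∀ p v, PolyFn (fun e => F (p + e • v))) :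
    LineOpen (k := k) {p | F p ≠ 0} := by
  intro p v e0 h
  simpa using (hF p v).finite_zero h

lemma lineOpen_forall_ne {ι : Type*} [Finite ι] (F : ι → E → k)
    (hF : ∀ i p v, PolyFn (fun e => F i (p + e • v))) :
    LineOpen (k := k) {p | ∀ i, F i p ≠ 0} := by
  cases nonempty_fintype ι
  have : {p | ∀ i, F i p ≠ 0} = {p | (∏ i, F i p) ≠ 0} := by
    ext p
    simp [Finset.prod_eq_zero_iff]
  rw [this]
  exact lineOpen_ne _ fun p v => PolyFn.prod _ fun i _ => hF i p v
end

section
variable {R : Type*} [AddCommGroup R] [Module k R]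

/-- the common kernel of a family of functionals on `M` -/
def kerOn {J : Type*} (M : Submodule k R) (φ : J → R →ₗ[k] k) : Submodule k R :=
  M ⊓ ⨅ j, LinearMap.ker (φ j)

lemma mem_kerOn {J : Type*} {M : Submodule k R} {φ : J → R →ₗ[k] k} {f : R} :
    f ∈ kerOn M φ ↔ f ∈ M ∧ ∀ j, φ j f = 0 := by
  simp [kerOn]

lemma kerOn_le {J : Type*} (M : Submodule k R) (φ : J → R →ₗ[k] k) : kerOn M φ ≤ M := inf_le_left

lemma finrank_mono' {A B : Submodule k R} [FiniteDimensional k B] (h : A ≤ B) :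
    Module.finrank k A ≤ Module.finrank k B := Submodule.finrank_mono h

lemma finrank_le_kerOn_add {ι : Type*} [Fintype ι] (M : Submodule k R) [FiniteDimensional k M]
    (φ : ι → R →ₗ[k] k) :
    Module.finrank k M ≤ Module.finrank k (kerOn M φ) + Fintype.card ι := by
  let T : M →ₗ[k] (ι → k) := (LinearMap.pi φ).comp M.subtype
  have h := T.finrank_range_add_finrank_ker
  have h1 : Module.finrank k (LinearMap.range T) ≤ Fintype.card ι := by
    simpa using Submodule.finrank_le (LinearMap.range T)
  have h2 : Module.finrank k (LinearMap.ker T) ≤ Module.finrank k (kerOn M φ) := by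
    have : FiniteDimensional k (kerOn M φ) :=
      Submodule.finiteDimensional_of_le (kerOn_le M φ)
    have : (LinearMap.ker T).map M.subtype ≤ kerOn M φ := by
      rintro _ ⟨x, hx, rfl⟩
      rw [mem_kerOn]
      refine ⟨x.2, fun j => ?_⟩
      have := congrFun (LinearMap.mem_ker.1 hx) j
      simpa [T] using this
    calc _ = Module.finrank k ((LinearMap.ker T).map M.subtype) :=
          (LinearEquiv.finrank_eq (Submodule.equivMapOfInjective _ M.injective_subtype _))
      _ ≤ _ := finrank_mono' this
  omega

lemma semicont {J : Type*} (M : Submodule k R) [FiniteDimensional k M] (φ : J → k → R →ₗ[k] k)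
    (hφ : ∀ j, ∀ f ∈ M, PolyFn (fun e => φ j e f)) (r : ℕ) (e0 : k)
    (h : Module.finrank k (kerOn M (fun j => φ j e0)) ≤ r) :
    {e | ¬ Module.finrank k (kerOn M (fun j => φ j e)) ≤ r}.Finite := by
  classical
  obtain ⟨C, hC⟩ := Submodule.exists_isCompl ((kerOn M (fun j => φ j e0)).comap M.subtype)
  let c := Module.finBasis k C
  let ψ : J → k → Module.Dual k C := fun j e => (φ j e).comp (M.subtype.comp C.subtype)
  have hspan : Submodule.span k (Set.range fun j => ψ j e0) = ⊤ := by
    have h0 : (Submodule.span k (Set.range fun j => ψ j e0)).dualCoannihilator = ⊥ := by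
      rw [eq_bot_iff]
      intro x hx
      rw [Submodule.mem_dualCoannihilator] at hx
      have hx1 : (x : M) ∈ (kerOn M (fun j => φ j e0)).comap M.subtype := by
        rw [Submodule.mem_comap, mem_kerOn]
        exact ⟨(x : M).2, fun j => hx _ (Submodule.subset_span ⟨j, rfl⟩)⟩
      have := Submodule.disjoint_def.1 hC.disjoint _ hx1 x.2
      simpa using this
    rw [← Subspace.dualCoannihilator_dualAnnihilator_eq (W := Submodule.span k (Set.range fun j => ψ j e0)), h0]
    simp
  have hfr : Module.finrank k (Submodule.span k (Set.range fun j => ψ j e0)) = Module.finrank k C := by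
    rw [hspan, finrank_top, Subspace.dual_finrank_eq]
  have hex := Submodule.exists_fun_fin_finrank_span_eq k (Set.range fun j => ψ j e0)
  rw [hfr] at hex
  obtain ⟨g, hg, hgs, -⟩ := hex
  choose a ha using hg
  let A : k → Matrix (Fin (Module.finrank k C)) (Fin (Module.finrank k C)) k :=
    fun e => Matrix.of fun i b => ψ (a i) e (c b)
  have hA0 : (A e0).det ≠ 0 := by
    intro hdet
    obtain ⟨v, hv, hv0⟩ := Matrix.exists_mulVec_eq_zero_iff.2 hdet
    apply hv
    have hz : ∀ i, g i (∑ b, v b • c b) = 0 := by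
      intro i
      have := congrFun hv0 i
      rw [← ha i]
      simp only [map_sum, map_smul, smul_eq_mul]
      simpa [A, Matrix.mulVec, dotProduct, mul_comm] using this
    have hall : ∀ l : Module.Dual k C, l (∑ b, v b • c b) = 0 := by
      intro l
      have hl : l ∈ Submodule.span k (Set.range g) := by rw [hgs, hspan]; trivial
      induction hl using Submodule.span_induction with
      | mem x hx => obtain ⟨i, rfl⟩ := hx; exact hz i
      | zero => simp
      | add x y _ _ hx hy => rw [LinearMap.add_apply, hx, hy, add_zero]
      | smul s x _ hx => rw [LinearMap.smul_apply, hx, smul_zero]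
    have hs : ∑ b, v b • c b = 0 := (Module.forall_dual_apply_eq_zero_iff k _).1 hall
    exact funext fun i => (Fintype.linearIndependent_iff.1 c.linearIndependent) v hs i
  have hpoly : PolyFn (fun e => (A e).det) := PolyFn.det fun i j => by
    simpa [A, ψ] using hφ (a i) _ (c j : M).2
  refine (hpoly.finite_zero hA0).subset fun e he => ?_
  simp only [Set.mem_ofPred_eq] at he ⊢
  by_contra hdet
  apply he
  have hdisj : Disjoint ((kerOn M (fun j => φ j e)).comap M.subtype) C := by
    rw [Submodule.disjoint_def]
    intro x hx hxC
    rw [Submodule.mem_comap, mem_kerOn] at hx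
    have hrep : (A e).mulVec (c.repr ⟨x, hxC⟩) = 0 := by
      funext i
      have h1 : ψ (a i) e ⟨x, hxC⟩ = 0 := hx.2 (a i)
      rw [← c.sum_repr ⟨x, hxC⟩] at h1
      simp only [map_sum, map_smul, smul_eq_mul] at h1
      simpa [A, Matrix.mulVec, dotProduct, mul_comm] using h1
    have h2 : (c.repr ⟨x, hxC⟩ : Fin _ → k) = 0 := by
      by_contra hne
      exact hdet (Matrix.exists_mulVec_eq_zero_iff.1 ⟨_, hne, hrep⟩)
    have h3 : c.repr ⟨x, hxC⟩ = 0 := by ext i; exact congrFun h2 i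
    have h4 : (⟨x, hxC⟩ : C) = 0 := by simpa using h3
    exact congrArg Subtype.val h4
  have d1 := Submodule.finrank_add_finrank_le_of_disjoint hdisj
  have d2 := Submodule.finrank_add_eq_of_isCompl hC
  have e1 : ∀ e, Module.finrank k ((kerOn M (fun j => φ j e)).comap M.subtype) =
      Module.finrank k (kerOn M (fun j => φ j e)) := fun e =>
    LinearEquiv.finrank_eq (Submodule.comapSubtypeEquivOfLe (kerOn_le M _))
  rw [e1] at d1 d2
  omega

lemma lineOpen_finrank {E : Type*} [AddCommGroup E] [Module k E] {J : Type*} (M : Submodule k R)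
    [FiniteDimensional k M] (Φ : J → E → R →ₗ[k] k)
    (hΦ : ∀ j p v, ∀ f ∈ M, PolyFn (fun e => Φ j (p + e • v) f)) (r : ℕ) :
    LineOpen (k := k) {p | Module.finrank k (kerOn M (fun j => Φ j p)) ≤ r} := by
  intro p v e0 h
  exact semicont M (fun j e => Φ j (p + e • v)) (fun j f hf => hΦ j p v f hf) r e0 h

lemma exists_points (M : Submodule k R) [FiniteDimensional k M] {X : Type*} (ev : X → R →ₗ[k] k)
    (sep : ∀ f ∈ M, f ≠ 0 → ∃ x, ev x f ≠ 0) (x0 : X) (p : ℕ) :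
    ∃ y : Fin p → X, Module.finrank k (kerOn M (fun i => ev (y i))) ≤ Module.finrank k M - p := by
  induction p with
  | zero =>
    refine ⟨fun _ => x0, ?_⟩
    simpa using finrank_mono' (kerOn_le M _)
  | succ p ih =>
    obtain ⟨y, hy⟩ := ih
    have fd : ∀ {J : Type} (φ : J → R →ₗ[k] k), FiniteDimensional k (kerOn M φ) := fun φ =>
      Submodule.finiteDimensional_of_le (kerOn_le M φ)
    by_cases hz : kerOn M (fun i => ev (y i)) = ⊥
    · refine ⟨Fin.snoc y x0, ?_⟩
      have : kerOn M (fun i => ev ((Fin.snoc y x0 : Fin (p+1) → X) i)) = ⊥ := by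
        rw [eq_bot_iff, ← hz]
        intro f hf
        rw [mem_kerOn] at hf ⊢
        refine ⟨hf.1, fun j => ?_⟩
        simpa using hf.2 j.castSucc
      rw [this]
      simp
    · obtain ⟨f, hf, hf0⟩ := Submodule.exists_mem_ne_zero_of_ne_bot hz
      obtain ⟨x, hx⟩ := sep f (kerOn_le M _ hf) hf0
      refine ⟨Fin.snoc y x, ?_⟩
      have hlt : kerOn M (fun i => ev ((Fin.snoc y x : Fin (p+1) → X) i)) <
          kerOn M (fun i => ev (y i)) := by
        refine lt_of_le_of_ne ?_ ?_
        · intro g hg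
          rw [mem_kerOn] at hg ⊢
          refine ⟨hg.1, fun j => ?_⟩
          simpa using hg.2 j.castSucc
        · intro heq
          rw [← heq, mem_kerOn] at hf
          exact hx (by simpa using hf.2 (Fin.last p))
      have := Submodule.finrank_lt_finrank_of_lt hlt
      omega

end
end PartA
end S15


namespace S15
section PartB
variable {k : Type} [Field k]

/-- forms of degree `d` in `N` variables -/
noncomputable abbrev Hm (k : Type) [Field k] (N d : ℕ) : Submodule k (MvPolynomial (Fin N) k) :=
  homogeneousSubmodule (Fin N) k d

instance finHm (N d : ℕ) : FiniteDimensional k (Hm k N d) :=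
  Module.Finite.iff_fg.2 (homogeneousSubmodule_fg (Fin N) k d)

lemma fin_of_le {N d : ℕ} {M : Submodule k (MvPolynomial (Fin N) k)} (h : M ≤ Hm k N d) :
    FiniteDimensional k M := Submodule.finiteDimensional_of_le h

lemma finrank_Hm (n d : ℕ) : Module.finrank k (Hm k (n+1) d) = (d+n).choose n := by
  have h : Hm k (n+1) d = AddMonoidAlgebra.supported k k {m : Fin (n+1) →₀ ℕ | m.degree = d} :=
    homogeneousSubmodule_eq_finsupp_supported _ _ _
  rw [h, (AddMonoidAlgebra.supportedEquivFinsupp _).finrank_eq]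
  have e : {m : Fin (n+1) →₀ ℕ | m.degree = d} = ↑(Finset.finsuppAntidiag (Finset.univ : Finset (Fin (n+1))) d) := by
    ext m
    simp [Finsupp.degree_eq_sum]
  rw [e, Module.finrank_finsupp_self, ← Nat.card_eq_fintype_card, Nat.card_coe_set_eq, Set.ncard_coe_finset, Finset.card_finsuppAntidiag_nat_eq_choose]
  rw [Finset.card_univ, Fintype.card_fin, show n + 1 + d - 1 = d + n by omega]
  exact (Nat.choose_symm_add)

/-- evaluation functional -/
noncomputable def evL {N : ℕ} (p : Fin N → k) : MvPolynomial (Fin N) k →ₗ[k] k :=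
  (aeval p).toLinearMap

@[simp] lemma evL_apply {N : ℕ} (p : Fin N → k) (f : MvPolynomial (Fin N) k) :
    evL p f = eval p f := by
  simp [evL, aeval_eq_eval]

/-- directional derivative functional -/
noncomputable def ddL {N : ℕ} (p w : Fin N → k) : MvPolynomial (Fin N) k →ₗ[k] k :=
  ∑ i, w i • ((evL p).comp (pderiv i).toLinearMap)

lemma ddL_apply {N : ℕ} (p w : Fin N → k) (f : MvPolynomial (Fin N) k) :
    ddL p w f = ∑ i, w i * eval p (pderiv i f) := by
  simp [ddL]

/-- restriction of a polynomial to the affine line `p + t w` -/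
noncomputable def lp {N : ℕ} (p w : Fin N → k) : MvPolynomial (Fin N) k →ₐ[k] Polynomial k :=
  aeval (fun i => Polynomial.C (p i) + Polynomial.X * Polynomial.C (w i))

lemma lp_eval {N : ℕ} (p w : Fin N → k) (f : MvPolynomial (Fin N) k) (e : k) :
    (lp p w f).eval e = eval (p + e • w) f := by
  have h : ((Polynomial.aeval e).comp (lp p w)) = (aeval (p + e • w) : MvPolynomial (Fin N) k →ₐ[k] k) := by
    ext i
    simp [lp]
    ring
  have := DFunLike.congr_fun h f
  simpa [aeval_eq_eval, Polynomial.coe_aeval_eq_eval] using this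

lemma lp_natDegree {N d : ℕ} (p w : Fin N → k) {f : MvPolynomial (Fin N) k} (hf : f ∈ Hm k N d) :
    (lp p w f).natDegree ≤ d := by
  have h1 : ∀ i : Fin N, (Polynomial.C (p i) + Polynomial.X * Polynomial.C (w i)).natDegree ≤ 1 := by
    intro i
    refine (Polynomial.natDegree_add_le _ _).trans (max_le ?_ ?_)
    · rw [Polynomial.natDegree_C]; omega
    · refine (Polynomial.natDegree_mul_le).trans ?_
      rw [Polynomial.natDegree_C, add_zero]
      exact Polynomial.natDegree_X_le
  have h2 := MvPolynomial.aeval_natDegree_le (m := d) (n := 1) f (IsHomogeneous.totalDegree_le hf) _ h1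
  rw [mul_one] at h2
  exact h2

lemma lp_coeff_zero {N : ℕ} (p w : Fin N → k) (f : MvPolynomial (Fin N) k) :
    (lp p w f).coeff 0 = eval p f := by
  rw [Polynomial.coeff_zero_eq_eval_zero, lp_eval]; simp

lemma lp_coeff_one {N : ℕ} (p w : Fin N → k) (f : MvPolynomial (Fin N) k) :
    (lp p w f).coeff 1 = ddL p w f := by
  induction f using MvPolynomial.induction_on with
  | C a => simp [lp, ddL_apply]
  | add f g hf hg => rw [map_add, Polynomial.coeff_add, hf, hg, map_add]
  | mul_X f i hf =>
    rw [map_mul, Polynomial.mul_coeff_one, hf, lp_coeff_zero, lp_coeff_zero]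
    have h1 : (lp p w (X i)).coeff 1 = w i := by simp [lp, Polynomial.coeff_C]
    rw [h1]
    classical
    simp only [ddL_apply, pderiv_mul, pderiv_X, map_add, map_mul, eval_X, mul_add, Finset.sum_add_distrib]
    have : ∑ x, w x * ((eval p) f * (eval p) (Pi.single (M := fun _ => MvPolynomial (Fin N) k) x 1 i)) = eval p f * w i := by
      rw [Finset.sum_eq_single i]
      · simp [mul_comm]
      · intro b _ hb; simp [hb.symm]
      · simp
    rw [this, Finset.sum_mul]
    rw [add_comm]
    congr 1
    exact Finset.sum_congr rfl fun _ _ => by ring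

lemma ddL_mul {N : ℕ} (p w : Fin N → k) (f g : MvPolynomial (Fin N) k) :
    ddL p w (f * g) = eval p f * ddL p w g + ddL p w f * eval p g := by
  rw [← lp_coeff_one, map_mul, Polynomial.mul_coeff_one, lp_coeff_zero, lp_coeff_zero,
    lp_coeff_one, lp_coeff_one]

/-- a form scales -/
lemma eval_smul {N d : ℕ} {f : MvPolynomial (Fin N) k} (hf : f ∈ Hm k N d) (s : k) (p : Fin N → k) :
    eval (s • p) f = s ^ d * eval p f := by
  rw [eval_eq, eval_eq, Finset.mul_sum]
  refine Finset.sum_congr rfl fun m hm => ?_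
  have hd : ∑ i ∈ m.support, m i = d := (IsHomogeneous.degree_eq_sum_deg_support hf hm).symm
  simp only [Pi.smul_apply, smul_eq_mul, mul_pow, Finset.prod_mul_distrib]
  rw [Finset.prod_pow_eq_pow_sum, hd]
  ring

/-- vanishing on a line -/
def vanL {N : ℕ} (f : MvPolynomial (Fin N) k) (a b : Fin N → k) : Prop :=
  ∀ s t : k, eval (s • a + t • b) f = 0

lemma vanL.left {N : ℕ} {f : MvPolynomial (Fin N) k} {a b : Fin N → k} (h : vanL f a b) : eval a f = 0 := by
  simpa using h 1 0
lemma vanL.right {N : ℕ} {f : MvPolynomial (Fin N) k} {a b : Fin N → k} (h : vanL f a b) : eval b f = 0 := by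
  simpa using h 0 1

/-- polynomial curves in a vector space -/
def PolyV {N : ℕ} (v : k → Fin N → k) : Prop := ∀ i, PolyFn (fun e => v e i)

lemma PolyV.const {N : ℕ} (p : Fin N → k) : PolyV (fun _ : k => p) := fun _ => PolyFn.const _
lemma PolyV.affine {N : ℕ} (p v : Fin N → k) : PolyV (fun e : k => p + e • v) := fun i => by
  simpa using PolyFn.affine (p i) (v i)
lemma PolyV.comb {N : ℕ} {u v : k → Fin N → k} (hu : PolyV u) (hv : PolyV v) (s t : k) :
    PolyV (fun e : k => s • u e + t • v e) := fun i => by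
  simpa using ((PolyFn.const s).mul (hu i)).add ((PolyFn.const t).mul (hv i))
lemma PolyV.evL {N : ℕ} {v : k → Fin N → k} (hv : PolyV v) (f : MvPolynomial (Fin N) k) :
    PolyFn (fun e => evL (v e) f) := by
  simpa using PolyFn.mvEval hv f
lemma PolyV.ddL {N : ℕ} {p w : k → Fin N → k} (hp : PolyV p) (hw : PolyV w) (f : MvPolynomial (Fin N) k) :
    PolyFn (fun e => ddL (p e) (w e) f) := by
  simp only [ddL_apply]
  exact PolyFn.sum _ fun i _ => (hw i).mul (PolyFn.mvEval hp _)

lemma PolyFn.eq_zero_of_ne [Infinite k] {g : k → k} (hg : PolyFn g) (e0 : k) (h : ∀ e ≠ e0, g e = 0) : g e0 = 0 := by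
  by_contra h0
  have h1 := hg.finite_zero h0
  have : (Set.univ : Set k) ⊆ {e | g e = 0} ∪ {e0} := fun e _ => by
    by_cases he : e = e0
    · right; exact he
    · left; exact h e he
  exact Set.infinite_univ ((h1.union (Set.finite_singleton e0)).subset this)

lemma vanL_of_points [CharZero k] {N d : ℕ} {f : MvPolynomial (Fin N) k} (hf : f ∈ Hm k N d) (a b : Fin N → k)
    (h : ∀ i : Fin (d+1), eval (a + ((i : ℕ) : k) • b) f = 0) : vanL f a b := by
  have h0 : lp a b f = 0 := by
    refine Polynomial.eq_zero_of_natDegree_lt_card_of_eval_eq_zero (lp a b f) (f := fun i : Fin (d+1) => ((i : ℕ) : k)) ?_ ?_ ?_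
    · intro i j hij
      simpa [Fin.ext_iff] using hij
    · intro i; rw [lp_eval]; exact h i
    · rw [Fintype.card_fin]; exact Nat.lt_succ_of_le (lp_natDegree a b hf)
  have hs : ∀ s : k, s ≠ 0 → ∀ t : k, eval (s • a + t • b) f = 0 := by
    intro s hs t
    have : s • a + t • b = s • (a + (t / s) • b) := by
      rw [smul_add, smul_smul, mul_div_cancel₀ _ hs]
    rw [this, eval_smul hf, ← lp_eval, h0]; simp
  intro s t
  by_cases h : s = 0
  · subst h
    have hp : PolyFn (fun s : k => eval (s • a + t • b) f) := by
      have := (PolyV.affine (t • b) a).evL f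
      simpa [add_comm] using this
    exact hp.eq_zero_of_ne 0 fun e he => hs e he t
  · exact hs s h t

end PartB
end S15


namespace S15
section PartC
variable {k : Type} [Field k]

/-- configurations: sundials `(P,u,v,w)` and lines `(a,b)` -/
abbrev Cfg (k : Type) (N : ℕ) (ι κ : Type) := (ι → Fin 4 → Fin N → k) × (κ → Fin 2 → Fin N → k)

/-- the functionals attached to a configuration; nilpotents imposed on `B` -/
noncomputable def cf {N : ℕ} {ι κ : Type} (B : Set ι) (C : Cfg k N ι κ) :
    (ι × Bool × k × k) ⊕ B ⊕ (κ × k × k) → MvPolynomial (Fin N) k →ₗ[k] k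
  | Sum.inl (i, b, s, t) => evL (s • C.1 i 0 + t • C.1 i (if b then 1 else 2))
  | Sum.inr (Sum.inl i) => ddL (C.1 i 0) (C.1 i 3)
  | Sum.inr (Sum.inr (l, s, t)) => evL (s • C.2 l 0 + t • C.2 l 1)

/-- elements of `M` satisfying the conditions of a configuration -/
noncomputable def Id {N : ℕ} {ι κ : Type} (M : Submodule k (MvPolynomial (Fin N) k)) (B : Set ι)
    (C : Cfg k N ι κ) : Submodule k (MvPolynomial (Fin N) k) := kerOn M (cf B C)

lemma mem_Id {N : ℕ} {ι κ : Type} {M : Submodule k (MvPolynomial (Fin N) k)} {B : Set ι}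
    {C : Cfg k N ι κ} {f : MvPolynomial (Fin N) k} : f ∈ Id M B C ↔ f ∈ M ∧
      (∀ i, vanL f (C.1 i 0) (C.1 i 1) ∧ vanL f (C.1 i 0) (C.1 i 2)) ∧
      (∀ i ∈ B, ddL (C.1 i 0) (C.1 i 3) f = 0) ∧ ∀ l, vanL f (C.2 l 0) (C.2 l 1) := by
  rw [Id, mem_kerOn]
  refine and_congr_right fun _ => ?_
  constructor
  · intro h
    refine ⟨fun i => ⟨fun s t => ?_, fun s t => ?_⟩, fun i hi => h (Sum.inr (Sum.inl ⟨i, hi⟩)), fun l s t => ?_⟩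
    · simpa [cf] using h (Sum.inl (i, true, s, t))
    · simpa [cf] using h (Sum.inl (i, false, s, t))
    · simpa [cf] using h (Sum.inr (Sum.inr (l, s, t)))
  · rintro ⟨h1, h2, h3⟩ (⟨i, b, s, t⟩ | i | ⟨l, s, t⟩)
    · cases b
      · simpa [cf] using (h1 i).2 s t
      · simpa [cf] using (h1 i).1 s t
    · exact h2 i i.2
    · simpa [cf] using h3 l s t

lemma Id_le {N : ℕ} {ι κ : Type} (M : Submodule k (MvPolynomial (Fin N) k)) (B : Set ι)
    (C : Cfg k N ι κ) : Id M B C ≤ M := kerOn_le _ _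

lemma polyfn_cf {N : ℕ} {ι κ : Type} (B : Set ι) (C : k → Cfg k N ι κ)
    (h1 : ∀ i j, PolyV (fun e => (C e).1 i j)) (h2 : ∀ l j, PolyV (fun e => (C e).2 l j)) (j)
    (f : MvPolynomial (Fin N) k) : PolyFn (fun e => cf B (C e) j f) := by
  rcases j with (⟨i, b, s, t⟩ | i | ⟨l, s, t⟩)
  · exact ((h1 i 0).comb (h1 i _) s t).evL f
  · exact (h1 i 0).ddL (h1 i 3) f
  · exact ((h2 l 0).comb (h2 l 1) s t).evL f

lemma Id_semicont {N : ℕ} {ι κ : Type} (M : Submodule k (MvPolynomial (Fin N) k))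
    [FiniteDimensional k M] (B : Set ι) (C : k → Cfg k N ι κ)
    (h1 : ∀ i j, PolyV (fun e => (C e).1 i j)) (h2 : ∀ l j, PolyV (fun e => (C e).2 l j))
    (r : ℕ) (e0 : k) (h : Module.finrank k (Id M B (C e0)) ≤ r) :
    {e | ¬ Module.finrank k (Id M B (C e)) ≤ r}.Finite :=
  semicont M (fun j e => cf B (C e) j) (fun j f _ => polyfn_cf B C h1 h2 j f) r e0 h

lemma lineOpen_Id {N : ℕ} {ι κ : Type} (M : Submodule k (MvPolynomial (Fin N) k))
    [FiniteDimensional k M] (B : Set ι) (r : ℕ) :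
    LineOpen (k := k) {C : Cfg k N ι κ | Module.finrank k (Id M B C) ≤ r} := by
  intro p v e0 h
  exact Id_semicont M B (fun e => p + e • v) (fun i j => PolyV.affine _ _) (fun i j => PolyV.affine _ _) r e0 h

/-- existence of a good configuration -/
def Good (k : Type) [Field k] (N d s c r : ℕ) : Prop :=
  ∃ C : Cfg k N (Fin s) (Fin c), Module.finrank k (Id (Hm k N d) Set.univ C) ≤ r

lemma finId {N d : ℕ} {ι κ : Type} (B : Set ι) (C : Cfg k N ι κ) :
    FiniteDimensional k (Id (Hm k N d) B C) := fin_of_le (Id_le _ _ _)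

lemma good_of {N d s c r : ℕ} {ι κ : Type} [Fintype ι] [Fintype κ] (hs : Fintype.card ι = s)
    (hc : Fintype.card κ = c) (C : Cfg k N ι κ)
    (h : Module.finrank k (Id (Hm k N d) Set.univ C) ≤ r) : Good k N d s c r := by
  let e1 := (Fintype.equivFinOfCardEq hs).symm
  let e2 := (Fintype.equivFinOfCardEq hc).symm
  refine ⟨(fun i => C.1 (e1 i), fun l => C.2 (e2 l)), le_trans (le_of_eq ?_) h⟩
  suffices hE : Id (Hm k N d) Set.univ ((fun i => C.1 (e1 i), fun l => C.2 (e2 l)) : Cfg k N (Fin s) (Fin c)) =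
      Id (Hm k N d) Set.univ C by rw [hE]
  ext f
  simp only [mem_Id, Set.mem_univ, true_implies]
  refine and_congr_right fun _ => ?_
  rw [e1.forall_congr_right (q := fun i => vanL f (C.1 i 0) (C.1 i 1) ∧ vanL f (C.1 i 0) (C.1 i 2)),
    e1.forall_congr_right (q := fun i => ddL (C.1 i 0) (C.1 i 3) f = 0),
    e2.forall_congr_right (q := fun l => vanL f (C.2 l 0) (C.2 l 1))]

lemma Good.mono {N d s c r r' : ℕ} (h : Good k N d s c r) (hr : r ≤ r') : Good k N d s c r' := by
  obtain ⟨C, hC⟩ := h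
  exact ⟨C, hC.trans hr⟩

lemma Good.add_line {N d s c r : ℕ} (h : Good k N d s c r) (j : ℕ) : Good k N d s (c+j) r := by
  obtain ⟨C, hC⟩ := h
  refine good_of (ι := Fin s) (κ := Fin c ⊕ Fin j) (by simp) (by simp) (C.1, Sum.elim C.2 0) (le_trans ?_ hC)
  have := finId (d := d) Set.univ C
  refine finrank_mono' fun f hf => ?_
  rw [mem_Id] at hf ⊢
  exact ⟨hf.1, hf.2.1, hf.2.2.1, fun l => hf.2.2.2 (Sum.inl l)⟩

lemma Good.remove_line [CharZero k] {N d s c r : ℕ} (j : ℕ) (h : Good k N d s (c+j) r) :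
    Good k N d s c (r+j*(d+1)) := by
  induction j generalizing r with
  | zero => simpa using h
  | succ j ih =>
  have h' : Good k N d s (c+j) (r+(d+1)) := by
    obtain ⟨C, hC⟩ := h
    let C' : Cfg k N (Fin s) (Fin (c+j)) := (C.1, fun l => C.2 l.castSucc)
    refine ⟨C', ?_⟩
    let φ : Fin (d+1) → MvPolynomial (Fin N) k →ₗ[k] k :=
      fun i => evL (C.2 (Fin.last _) 0 + ((i : ℕ) : k) • C.2 (Fin.last _) 1)
    have := finId (d := d) Set.univ C
    have := finId (d := d) Set.univ C'
    have h1 := finrank_le_kerOn_add (Id (Hm k N d) Set.univ C') φ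
    have h2 : kerOn (Id (Hm k N d) Set.univ C') φ ≤ Id (Hm k N d) Set.univ C := by
      intro f hf
      rw [mem_kerOn, mem_Id] at hf
      obtain ⟨⟨h1, h2, h3, h4⟩, h5⟩ := hf
      rw [mem_Id]
      refine ⟨h1, h2, h3, fun l => ?_⟩
      refine Fin.lastCases ?_ (fun l => ?_) l
      · exact vanL_of_points h1 _ _ fun i => by simpa [φ] using h5 i
      · exact h4 l
    have h3 := finrank_mono' h2
    simp only [Fintype.card_fin] at h1
    omega
  have := ih h'
  have e : r + (j+1)*(d+1) = r + (d+1) + j * (d+1) := by ring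
  rw [e]
  exact this

/-- difference quotient functional -/
noncomputable def dq {N : ℕ} (P w : Fin N → k) (e : k) : MvPolynomial (Fin N) k →ₗ[k] k :=
  open Classical in
  if e = 0 then ddL P w else e⁻¹ • (evL (P + e • w) - evL P)

lemma dq_zero {N : ℕ} (P w : Fin N → k) : dq P w 0 = ddL P w := by simp [dq]

lemma dq_poly {N : ℕ} (P w : Fin N → k) (f : MvPolynomial (Fin N) k) : PolyFn (fun e => dq P w e f) := by
  refine ⟨(lp P w f).divX, fun e => ?_⟩
  by_cases he : e = 0
  · subst he
    change dq P w 0 f = _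
    rw [dq_zero, ← lp_coeff_one, ← Polynomial.coeff_zero_eq_eval_zero, Polynomial.coeff_divX]
  · have h := congrArg (Polynomial.eval e) (Polynomial.X_mul_divX_add (lp P w f))
    rw [Polynomial.eval_add, Polynomial.eval_mul, Polynomial.eval_X, Polynomial.eval_C, lp_eval, lp_coeff_zero] at h
    simp only [dq, he, if_false, LinearMap.smul_apply, LinearMap.sub_apply, evL_apply, smul_eq_mul]
    rw [← h]
    field_simp
    ring

lemma Good.convert [CharZero k] {N d s c r : ℕ} (h : Good k N d (s+1) c r) : Good k N d s (c+2) r := by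
  obtain ⟨C, hC⟩ := h
  let P := C.1 (Fin.last s) 0
  let u := C.1 (Fin.last s) 1
  let v := C.1 (Fin.last s) 2
  let w := C.1 (Fin.last s) 3
  let D : k → Cfg k N (Fin s) (Fin c ⊕ Fin 2) := fun e =>
    (fun i => C.1 i.castSucc, Sum.elim C.2 ![![P, u], ![P + e • w, v]])
  let ψ : (Unit ⊕ _) → k → MvPolynomial (Fin N) k →ₗ[k] k := fun j e => Sum.elim (fun _ : Unit => dq P w e) (cf Set.univ (D e)) j
  have hψ := semicont (Hm k N d) ψ (by
    rintro (_ | j) f _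
    · exact dq_poly P w f
    · refine polyfn_cf _ D (fun i j => PolyV.const _) (fun l j => ?_) j f
      rcases l with l | l
      · exact PolyV.const _
      · fin_cases l <;> fin_cases j <;> simp only [D] 
        · exact PolyV.const _
        · exact PolyV.const _
        · exact PolyV.affine _ _
        · exact PolyV.const _) r 0 (by
      refine le_trans ?_ hC
      have := finId (d := d) Set.univ C
      refine finrank_mono' fun f hf => ?_
      rw [mem_kerOn] at hf
      have h0 : ddL P w f = 0 := by rw [← dq_zero]; exact hf.2 (Sum.inl ())
      have h1 : f ∈ Id (Hm k N d) Set.univ (D 0) := mem_kerOn.2 ⟨hf.1, fun j => hf.2 (Sum.inr j)⟩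
      rw [mem_Id] at h1 ⊢
      refine ⟨h1.1, fun i => ?_, fun i _ => ?_, fun l => h1.2.2.2 (Sum.inl l)⟩
      · refine Fin.lastCases ?_ (fun i => h1.2.1 i) i
        have a1 := h1.2.2.2 (Sum.inr 0)
        have a2 := h1.2.2.2 (Sum.inr 1)
        exact ⟨by simpa [D] using a1, by simpa [D] using a2⟩
      · refine Fin.lastCases h0 (fun i => h1.2.2.1 i trivial) i)
  obtain ⟨e, he⟩ := (hψ.union (Set.finite_singleton 0)).exists_notMem
  simp only [Set.mem_ofPred_eq, Set.mem_union, not_or, not_not, Set.mem_singleton_iff] at he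
  refine good_of (by simp) (by simp) (D e) (le_trans ?_ he.1)
  have : FiniteDimensional k (kerOn (Hm k N d) fun j => ψ j e) := fin_of_le (kerOn_le _ _)
  refine finrank_mono' fun f hf => ?_
  have hf' := hf
  rw [Id, mem_kerOn] at hf
  refine mem_kerOn.2 ⟨hf.1, ?_⟩
  rintro (_ | j)
  · rw [mem_Id] at hf'
    have a1 : eval P f = 0 := (hf'.2.2.2 (Sum.inr 0)).left
    have a2 : eval (P + e • w) f = 0 := (hf'.2.2.2 (Sum.inr 1)).left
    simp [ψ, dq, he.2, a1, a2]
  · exact hf.2 j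

lemma Good.converts [CharZero k] {N d s c r : ℕ} (j : ℕ) (h : Good k N d (s+j) c r) : Good k N d s (c+2*j) r := by
  induction j generalizing c with
  | zero => simpa using h
  | succ j ih =>
    have := ih (c := c+2) (Good.convert (by simpa [add_assoc] using h))
    have e : c + 2 * (j+1) = c + 2 + 2 * j := by ring
    rw [e]; exact this

end PartC
end S15


namespace S15
section PartD
variable {k : Type} [Field k]

/-- inclusion of the hyperplane `x_0 = 0` -/
def inc {N : ℕ} : (Fin N → k) →ₗ[k] (Fin (N+1) → k) where
  toFun y := Fin.cons 0 y
  map_add' x y := by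
    funext i
    refine Fin.cases ?_ (fun i => ?_) i <;> simp
  map_smul' x y := by
    funext i
    refine Fin.cases ?_ (fun i => ?_) i <;> simp

@[simp] lemma inc_zero' {N : ℕ} (y : Fin N → k) : inc y 0 = 0 := rfl
@[simp] lemma inc_succ {N : ℕ} (y : Fin N → k) (i : Fin N) : inc y i.succ = y i := rfl

lemma inc_tail {N : ℕ} (y : Fin (N+1) → k) (h : y 0 = 0) : inc (fun i => y i.succ) = y := by
  funext i
  refine Fin.cases ?_ (fun i => ?_) i
  · simp [h]
  · simp

/-- restriction to the hyperplane -/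
noncomputable def rho {N : ℕ} : MvPolynomial (Fin (N+1)) k →ₐ[k] MvPolynomial (Fin N) k :=
  aeval (Fin.cons 0 X)

lemma eval_rho {N : ℕ} (y : Fin N → k) (f : MvPolynomial (Fin (N+1)) k) :
    eval y (rho f) = eval (inc y) f := by
  have h : (aeval y : MvPolynomial (Fin N) k →ₐ[k] k).comp rho = (aeval (inc y) : MvPolynomial (Fin (N+1)) k →ₐ[k] k) := by
    ext i
    refine Fin.cases ?_ (fun i => ?_) i <;> simp [rho]
  have := DFunLike.congr_fun h f
  simpa [aeval_eq_eval] using this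

lemma lp_rho {N : ℕ} (y w : Fin N → k) (f : MvPolynomial (Fin (N+1)) k) :
    lp y w (rho f) = lp (inc y) (inc w) f := by
  have h : (lp y w).comp rho = lp (inc y) (inc w) := by
    ext i
    refine Fin.cases ?_ (fun i => ?_) i <;> simp [rho, lp]
  exact DFunLike.congr_fun h f

lemma ddL_rho {N : ℕ} (y w : Fin N → k) (f : MvPolynomial (Fin (N+1)) k) :
    ddL y w (rho f) = ddL (inc y) (inc w) f := by
  rw [← lp_coeff_one, ← lp_coeff_one, lp_rho]

lemma rho_mem {N d : ℕ} {f : MvPolynomial (Fin (N+1)) k} (hf : f ∈ Hm k (N+1) d) : rho f ∈ Hm k N d := by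
  have h : ∀ i : Fin (N+1), ((Fin.cons 0 X : Fin (N+1) → MvPolynomial (Fin N) k) i).IsHomogeneous 1 := by
    intro i
    refine Fin.cases ?_ (fun i => ?_) i
    · exact isHomogeneous_zero _ _ _
    · exact isHomogeneous_X _ _
  have := IsHomogeneous.aeval (m := d) (n := 1) hf _ h
  rw [one_mul] at this
  exact this

lemma X0_dvd_sub {N : ℕ} (f : MvPolynomial (Fin (N+1)) k) : X 0 ∣ f - rename Fin.succ (rho f) := by
  induction f using MvPolynomial.induction_on with
  | C a => simp [rho]
  | add f g hf hg =>
    have := dvd_add hf hg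
    simp only [map_add]
    convert this using 1
    ring
  | mul_X f i hf =>
    rw [map_mul, map_mul]
    refine Fin.cases ?_ (fun i => ?_) i
    · simp [rho]
    · have : rename Fin.succ (rho (X i.succ : MvPolynomial (Fin (N+1)) k)) = X i.succ := by simp [rho]
      rw [this, ← sub_mul]
      exact Dvd.dvd.mul_right hf _

lemma rho_ker {N d : ℕ} {f : MvPolynomial (Fin (N+1)) k} (hf : f ∈ Hm k (N+1) (d+1)) (h : rho f = 0) :
    ∃ g ∈ Hm k (N+1) d, f = X 0 * g := by
  have h1 := X0_dvd_sub f
  rw [h, map_zero, sub_zero] at h1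
  obtain ⟨g, hg⟩ := h1
  refine ⟨g, ?_, hg⟩
  rw [mem_homogeneousSubmodule]
  rw [mem_homogeneousSubmodule] at hf
  intro m hm
  have h2 : coeff (m + Finsupp.single 0 1) f ≠ 0 := by
    rw [hg, mul_comm, coeff_mul_X]
    exact hm
  have h3 := hf h2
  rw [map_add] at h3
  have : Finsupp.weight 1 (Finsupp.single (0 : Fin (N+1)) 1) = 1 := by
    simp [Finsupp.weight_single]
  omega

lemma ddL_X0_mul {N : ℕ} (p w : Fin (N+1) → k) (g : MvPolynomial (Fin (N+1)) k) :
    ddL p w (X 0 * g) = p 0 * ddL p w g + w 0 * eval p g := by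
  rw [ddL_mul]
  congr 1
  · simp
  · congr 1
    rw [← lp_coeff_one]
    simp [lp, Polynomial.coeff_C]

lemma form_eq_zero [Infinite k] {N d : ℕ} {f : MvPolynomial (Fin N) k} (_hf : f ∈ Hm k N d)
    (h : ∀ p, eval p f = 0) : f = 0 :=
  MvPolynomial.funext fun p => by simpa using h p

lemma vanL_div1 [Infinite k] {N : ℕ} {g : MvPolynomial (Fin (N+1)) k} {P u : Fin (N+1) → k} (hP : P 0 ≠ 0) (hu : u 0 = 0)
    (h : vanL (X 0 * g) P u) : vanL g P u := by
  have h1 : ∀ s : k, s ≠ 0 → ∀ t : k, eval (s • P + t • u) g = 0 := by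
    intro s hs t
    have := h s t
    rw [map_mul, eval_X] at this
    simpa [hu, hs, hP] using this
  intro s t
  by_cases hs : s = 0
  · subst hs
    have hp : PolyFn (fun s : k => eval (s • P + t • u) g) := by
      have := (PolyV.affine (t • u) P).evL g
      simpa [add_comm] using this
    exact hp.eq_zero_of_ne 0 fun e he => h1 e he t
  · exact h1 s hs t

lemma vanL.symm {N : ℕ} {g : MvPolynomial (Fin N) k} {a b : Fin N → k} (h : vanL g a b) : vanL g b a := by
  intro s t
  rw [add_comm]
  exact h t s

lemma vanL.rebase {N : ℕ} {g : MvPolynomial (Fin N) k} {a b : Fin N → k} (c : k) (h : vanL g a b) : vanL g a (b - c • a) := by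
  intro s t
  rw [show s • a + t • (b - c • a) = (s - t * c) • a + t • b by module]
  exact h (s - t * c) t

lemma vanL_rebase {N : ℕ} {g : MvPolynomial (Fin N) k} {a b : Fin N → k} (c : k) : vanL g a (b - c • a) ↔ vanL g a b := by
  refine ⟨fun h => ?_, fun h => h.rebase c⟩
  have := h.rebase (-c)
  simpa using this

/-- parameter space for the residual configurations -/
abbrev Par (k : Type) (N s c : ℕ) :=
  ((Fin s → Fin 2 → Fin (N+1) → k) × (Fin s → Fin 2 → Fin N → k)) ×
    ((Fin c → Fin N → k) × (Fin c → Fin (N+1) → k))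

/-- configuration attached to a parameter -/
def lam {N s c : ℕ} : Par k N s c →ₗ[k] Cfg k (N+1) (Fin s) (Fin c) where
  toFun Y := (fun i => ![Y.1.1 i 0, inc (Y.1.2 i 0), inc (Y.1.2 i 1), Y.1.1 i 1],
    fun l => ![inc (Y.2.1 l), Y.2.2 l])
  map_add' x y := by
    refine Prod.ext ?_ ?_
    · funext i j
      fin_cases j <;> simp
    · funext i j
      fin_cases j <;> simp
  map_smul' x y := by
    refine Prod.ext ?_ ?_
    · funext i j
      fin_cases j <;> simp
    · funext i j
      fin_cases j <;> simp

/-- nondegeneracy -/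
def Nd {N s c : ℕ} : Set (Par k N s c) :=
  {Y | ∀ i, Y.1.1 i 0 0 ≠ 0} ∩ {Y | ∀ l, Y.2.2 l 0 ≠ 0}

lemma lineOpen_Nd {N s c : ℕ} : LineOpen (k := k) (Nd : Set (Par k N s c)) := by
  refine LineOpen.inter ?_ ?_
  · exact lineOpen_forall_ne (fun i (Y : Par k N s c) => Y.1.1 i 0 0) fun i p v => by
      simpa using PolyFn.affine _ _
  · exact lineOpen_forall_ne (fun i (Y : Par k N s c) => Y.2.2 i 0) fun i p v => by
      simpa using PolyFn.affine _ _

lemma mem_Id_lam {N s c : ℕ} {M : Submodule k (MvPolynomial (Fin (N+1)) k)} {Y : Par k N s c} {f} :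
    f ∈ Id M Set.univ (lam Y) ↔ f ∈ M ∧
      (∀ i, vanL f (Y.1.1 i 0) (inc (Y.1.2 i 0)) ∧ vanL f (Y.1.1 i 0) (inc (Y.1.2 i 1))) ∧
      (∀ i, ddL (Y.1.1 i 0) (Y.1.1 i 1) f = 0) ∧ ∀ l, vanL f (inc (Y.2.1 l)) (Y.2.2 l) := by
  rw [mem_Id]
  simp [lam]

lemma div_mem [Infinite k] {N s c d : ℕ} {Y : Par k N s c} (hY : Y ∈ Nd) {M : Submodule k (MvPolynomial (Fin (N+1)) k)} 
    {g : MvPolynomial (Fin (N+1)) k} (hg : g ∈ Hm k (N+1) d) (h : X 0 * g ∈ Id M Set.univ (lam Y)) :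
    g ∈ Id (Hm k (N+1) d) Set.univ (lam Y) := by
  rw [mem_Id_lam] at h ⊢
  obtain ⟨-, h1, h2, h3⟩ := h
  have h4 : ∀ i, vanL g (Y.1.1 i 0) (inc (Y.1.2 i 0)) := fun i => vanL_div1 (hY.1 i) rfl (h1 i).1
  refine ⟨hg, fun i => ⟨h4 i, vanL_div1 (hY.1 i) rfl (h1 i).2⟩, fun i => ?_, fun l => ?_⟩
  · have := h2 i
    rw [ddL_X0_mul, (h4 i).left, mul_zero, add_zero] at this
    exact (mul_eq_zero.1 this).resolve_left (hY.1 i)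
  · exact (vanL_div1 (hY.2 l) rfl (h3 l).symm).symm

lemma exists_rebase {N s c : ℕ} (C : Cfg k (N+1) (Fin s) (Fin c)) (h1 : ∀ i, C.1 i 0 0 ≠ 0)
    (h2 : ∀ l, C.2 l 1 0 ≠ 0) : ∃ Y : Par k N s c, Y ∈ Nd ∧ ∀ M, Id M Set.univ (lam Y) = Id M Set.univ C := by
  let r : Fin s → Fin 4 → Fin (N+1) → k := fun i j => C.1 i j - (C.1 i j 0 / C.1 i 0 0) • C.1 i 0
  have hr : ∀ i j, inc (fun x => r i j x.succ) = r i j := fun i j => inc_tail _ (by simp [r, h1 i])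
  let q : Fin c → Fin (N+1) → k := fun l => C.2 l 0 - (C.2 l 0 0 / C.2 l 1 0) • C.2 l 1
  have hq : ∀ l, inc (fun x => q l x.succ) = q l := fun i => inc_tail _ (by simp [q, h2 i])
  refine ⟨((fun i => ![C.1 i 0, C.1 i 3], fun i => ![fun x => r i 1 x.succ, fun x => r i 2 x.succ]),
    (fun l x => q l x.succ, fun l => C.2 l 1)), ⟨fun i => by simpa using h1 i, fun l => h2 l⟩, fun M => ?_⟩
  ext f
  rw [mem_Id_lam, mem_Id]
  simp only [Matrix.cons_val_zero, Matrix.cons_val_one, hr, hq, Set.mem_univ, true_implies]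
  have a1 : ∀ i j, vanL f (C.1 i 0) (r i j) ↔ vanL f (C.1 i 0) (C.1 i j) := fun i j => vanL_rebase _
  have a2 : ∀ l, vanL f (q l) (C.2 l 1) ↔ vanL f (C.2 l 0) (C.2 l 1) := fun l => by
    rw [show vanL f (q l) (C.2 l 1) ↔ vanL f (C.2 l 1) (q l) from ⟨vanL.symm, vanL.symm⟩, vanL_rebase]
    exact ⟨vanL.symm, vanL.symm⟩
  simp only [a1, a2]

lemma finrank_le_zero_mem {R : Type*} [AddCommGroup R] [Module k R] {M : Submodule k R} [FiniteDimensional k M]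
    (h : Module.finrank k M ≤ 0) {f : R} (hf : f ∈ M) : f = 0 := by
  have : M = ⊥ := Submodule.finrank_eq_zero.1 (by omega)
  rw [this] at hf
  exact hf

lemma exists_residual [CharZero k] {N d s' c' e : ℕ} (hY : Good k (N+1) (d+1) s' c' e)
    (hY2 : e = 0 ∨ Good k (N+1) d s' c' 0) : ∃ Y : Par k N s' c', Y ∈ Nd ∧
      Module.finrank k (Id (Hm k (N+1) (d+1)) Set.univ (lam Y)) ≤ e ∧
      (e = 0 ∨ Module.finrank k (Id (Hm k (N+1) d) Set.univ (lam Y)) ≤ 0) := by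
  have o1 := lineOpen_Id (k := k) (ι := Fin s') (κ := Fin c') (Hm k (N+1) (d+1)) Set.univ e
  have o2 : LineOpen (k := k) {C : Cfg k (N+1) (Fin s') (Fin c') | e = 0 ∨ Module.finrank k (Id (Hm k (N+1) d) Set.univ C) ≤ 0} := by
    by_cases he : e = 0
    · intro p v e0 _
      simp [he]
    · simp only [he, false_or]
      exact lineOpen_Id (Hm k (N+1) d) Set.univ 0
  have n2 : {C : Cfg k (N+1) (Fin s') (Fin c') | e = 0 ∨ Module.finrank k (Id (Hm k (N+1) d) Set.univ C) ≤ 0}.Nonempty := by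
    rcases hY2 with h | ⟨C, hC⟩
    · exact ⟨0, Or.inl h⟩
    · exact ⟨C, Or.inr hC⟩
  have o3 : LineOpen (k := k) ({C | ∀ i, C.1 i 0 0 ≠ 0} : Set (Cfg k (N+1) (Fin s') (Fin c'))) :=
    lineOpen_forall_ne (fun i (C : Cfg k (N+1) (Fin s') (Fin c')) => C.1 i 0 0) fun i p v => by
      simpa using PolyFn.affine _ _
  have o4 : LineOpen (k := k) ({C | ∀ l, C.2 l 1 0 ≠ 0} : Set (Cfg k (N+1) (Fin s') (Fin c'))) :=
    lineOpen_forall_ne (fun i (C : Cfg k (N+1) (Fin s') (Fin c')) => C.2 i 1 0) fun i p v => by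
      simpa using PolyFn.affine _ _
  have n34 : (({C | ∀ i, C.1 i 0 0 ≠ 0} : Set (Cfg k (N+1) (Fin s') (Fin c'))) ∩ {C | ∀ l, C.2 l 1 0 ≠ 0}).Nonempty :=
    ⟨(fun _ _ _ => 1, fun _ _ _ => 1), fun i => one_ne_zero, fun i => one_ne_zero⟩
  obtain ⟨C, ⟨c1, c2⟩, c3, c4⟩ := (o1.inter o2).inter_nonempty (o3.inter o4) (o1.inter_nonempty o2 hY n2) n34
  obtain ⟨Y, y1, y2⟩ := exists_rebase C c3 c4
  refine ⟨Y, y1, ?_, ?_⟩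
  · rw [y2]; exact c1
  · rw [y2]; exact c2

lemma step [CharZero k] {N d z cz s' c' A e : ℕ} (hZ : Good k N (d+2) z cz A)
    (hY : Good k (N+1) (d+1) s' c' e) (hez : e ≤ z) (hY2 : e = 0 ∨ Good k (N+1) d s' c' 0) :
    Good k (N+1) (d+2) (z+s') (cz+c') (A + e - (2*s'+c')) := by
  classical
  obtain ⟨Y0, hN0, hr0, hr1⟩ := exists_residual hY hY2
  -- points killing the residual forms
  have f0 := finId (d := d+1) Set.univ (lam Y0)
  have hsep : ∀ g ∈ Id (Hm k (N+1) (d+1)) Set.univ (lam Y0), g ≠ 0 → ∃ x : Fin N → k, evL (inc x) g ≠ 0 := by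
    intro g hg hg0
    by_contra hcon
    simp only [evL_apply, not_exists, not_not] at hcon
    apply hg0
    rcases hr1 with h | h
    · subst h
      exact finrank_le_zero_mem hr0 hg
    · have hgH := Id_le _ _ _ hg
      have : rho g = 0 := form_eq_zero (rho_mem hgH) fun p => by rw [eval_rho]; exact hcon p
      obtain ⟨g', hg', rfl⟩ := rho_ker hgH this
      have h3 := div_mem hN0 hg' hg
      have f1 := finId (d := d) Set.univ (lam Y0)
      rw [finrank_le_zero_mem h h3, mul_zero]
  obtain ⟨p, hp⟩ := exists_points (Id (Hm k (N+1) (d+1)) Set.univ (lam Y0)) (fun x : Fin N → k => evL (inc x)) hsep 0 e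
  -- choose `Z`
  have o1 := lineOpen_Id (k := k) (ι := Fin z) (κ := Fin cz) (Hm k N (d+2)) Set.univ A
  have o2 := lineOpen_finrank (E := Cfg k N (Fin z) (Fin cz)) (Id (Hm k (N+1) (d+1)) Set.univ (lam Y0))
    (fun (j : Fin e) C => evL (inc (C.1 (Fin.castLE hez j) 0))) (fun j q v f _ => by
      have := (PolyV.affine (inc (q.1 (Fin.castLE hez j) 0)) (inc (v.1 (Fin.castLE hez j) 0))).evL f
      simpa using this) 0
  have n2 : {C : Cfg k N (Fin z) (Fin cz) | Module.finrank k (kerOn (Id (Hm k (N+1) (d+1)) Set.univ (lam Y0))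
      (fun j : Fin e => evL (inc (C.1 (Fin.castLE hez j) 0)))) ≤ 0}.Nonempty := by
    refine ⟨(fun i _ => if h : (i : ℕ) < e then p ⟨i, h⟩ else 0, 0), ?_⟩
    have he : (fun j : Fin e => evL (inc (if h : ((Fin.castLE hez j : Fin z) : ℕ) < e then p ⟨(Fin.castLE hez j : Fin z), h⟩ else 0))) =
        fun j : Fin e => evL (inc (p j)) := by
      funext j
      rw [dif_pos (show ((Fin.castLE hez j : Fin z) : ℕ) < e from j.2)]
      rfl
    simp only [Set.mem_ofPred_eq]
    rw [he]
    exact hp.trans (by omega)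
  obtain ⟨Z, hZA, hZk⟩ := o1.inter_nonempty o2 hZ n2
  simp only [Set.mem_ofPred_eq] at hZA hZk
  -- the space on the hyperplane
  let B : Set (Fin z) := {i | e ≤ (i : ℕ)}
  let W := Id (Hm k N (d+2)) B Z
  have fW : FiniteDimensional k W := finId B Z
  have hW : Module.finrank k W ≤ A + e := by
    have h1 := finrank_le_kerOn_add W (fun j : Fin e => ddL (Z.1 (Fin.castLE hez j) 0) (Z.1 (Fin.castLE hez j) 3))
    have h2 : kerOn W (fun j : Fin e => ddL (Z.1 (Fin.castLE hez j) 0) (Z.1 (Fin.castLE hez j) 3)) ≤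
        Id (Hm k N (d+2)) Set.univ Z := by
      intro f hf
      rw [mem_kerOn, mem_Id] at hf
      obtain ⟨⟨h1, h2, h3, h4⟩, h5⟩ := hf
      rw [mem_Id]
      refine ⟨h1, h2, fun i _ => ?_, h4⟩
      by_cases hi : (i : ℕ) < e
      · exact h5 ⟨i, hi⟩
      · exact h3 i (not_lt.1 hi)
    have f2 := finId (d := d+2) Set.univ Z
    have h3 := finrank_mono' h2
    rw [Fintype.card_fin] at h1
    omega
  -- choose `Y`
  let M' : Submodule k (MvPolynomial (Fin (N+1)) k) := kerOn (Hm k (N+1) (d+1)) (fun j : Fin e => evL (inc (Z.1 (Fin.castLE hez j) 0)))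
  have fM' : FiniteDimensional k M' := fin_of_le (kerOn_le _ _)
  have o3 := (lineOpen_Id (k := k) (ι := Fin s') (κ := Fin c') M' Set.univ 0).preimage (lam (N := N))
  have n3 : (lam (N := N) ⁻¹' {C : Cfg k (N+1) (Fin s') (Fin c') | Module.finrank k (Id M' Set.univ C) ≤ 0}).Nonempty := by
    refine ⟨Y0, ?_⟩
    refine le_trans ?_ hZk
    have : FiniteDimensional k (kerOn (Id (Hm k (N+1) (d+1)) Set.univ (lam Y0)) (fun j : Fin e => evL (inc (Z.1 (Fin.castLE hez j) 0)))) :=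
      Submodule.finiteDimensional_of_le (kerOn_le _ _)
    refine finrank_mono' fun f hf => ?_
    rw [mem_Id, mem_kerOn] at hf
    rw [mem_kerOn, mem_Id]
    exact ⟨⟨hf.1.1, hf.2⟩, hf.1.2⟩
  let pts : (Fin s' × Fin 2) ⊕ Fin c' → Par k N s' c' → (Fin N → k) :=
    fun j Y => Sum.elim (fun q => Y.1.2 q.1 q.2) (fun l => Y.2.1 l) j
  have o4 := lineOpen_finrank (E := Par k N s' c') W (fun j Y => evL (pts j Y)) (fun j q v f _ => by
      rcases j with j | j
      · exact (PolyV.affine (q.1.2 j.1 j.2) (v.1.2 j.1 j.2)).evL f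
      · exact (PolyV.affine (q.2.1 j) (v.2.1 j)).evL f) (Module.finrank k W - (2*s'+c'))
  have n4 : {Y : Par k N s' c' | Module.finrank k (kerOn W (fun j => evL (pts j Y))) ≤ Module.finrank k W - (2*s'+c')}.Nonempty := by
    obtain ⟨y, hy⟩ := exists_points W (fun x : Fin N → k => evL x) (fun f hf hf0 => by
      by_contra hcon
      simp only [evL_apply, not_exists, not_not] at hcon
      exact hf0 (form_eq_zero (Id_le _ _ _ hf) hcon)) 0 (2*s'+c')
    have hcard : Fintype.card ((Fin s' × Fin 2) ⊕ Fin c') = 2*s'+c' := by simp [mul_comm]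
    let E := Fintype.equivFinOfCardEq hcard
    refine ⟨((0, fun i j => y (E (Sum.inl (i, j)))), (fun l => y (E (Sum.inr l)), 0)), ?_⟩
    refine le_trans ?_ hy
    have : FiniteDimensional k (kerOn W (fun i => evL (y i))) := Submodule.finiteDimensional_of_le (kerOn_le _ _)
    refine finrank_mono' fun f hf => ?_
    rw [mem_kerOn] at hf ⊢
    refine ⟨hf.1, fun j => ?_⟩
    have := hf.2 (E.symm j)
    rw [← E.apply_symm_apply j]
    rcases h : E.symm j with q | q
    · rw [h] at this; exact this
    · rw [h] at this; exact this
  have n5 : (Nd : Set (Par k N s' c')).Nonempty := ⟨Y0, hN0⟩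
  obtain ⟨Y, ⟨hY3, hY4⟩, hYN⟩ := (o3.inter o4).inter_nonempty lineOpen_Nd (o3.inter_nonempty o4 n3 n4) n5
  simp only [Set.mem_preimage, Set.mem_ofPred_eq] at hY3 hY4
  -- the final configuration
  let Xc : Cfg k (N+1) (Fin z ⊕ Fin s') (Fin cz ⊕ Fin c') :=
    (Sum.elim (fun i => ![inc (Z.1 i 0), inc (Z.1 i 1), inc (Z.1 i 2), if (i : ℕ) < e then Pi.single 0 1 else inc (Z.1 i 3)]) (lam Y).1,
      Sum.elim (fun l => ![inc (Z.2 l 0), inc (Z.2 l 1)]) (lam Y).2)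
  refine good_of (by simp) (by simp) Xc ?_
  have hmem : ∀ f ∈ Id (Hm k (N+1) (d+2)) Set.univ Xc, f ∈ Id (Hm k (N+1) (d+2)) Set.univ (lam Y) := by
    intro f hf
    rw [mem_Id] at hf ⊢
    exact ⟨hf.1, fun i => hf.2.1 (Sum.inr i), fun i _ => hf.2.2.1 (Sum.inr i) trivial, fun l => hf.2.2.2 (Sum.inr l)⟩
  have hvan : ∀ (f : MvPolynomial (Fin (N+1)) k) (a b : Fin N → k), vanL f (inc a) (inc b) → vanL (rho f) a b := by
    intro f a b h s t
    rw [eval_rho, map_add, map_smul, map_smul]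
    exact h s t
  have htr : ∀ f ∈ Id (Hm k (N+1) (d+2)) Set.univ Xc, rho f ∈ kerOn W (fun j => evL (pts j Y)) := by
    intro f hf
    have hf2 := hmem f hf
    rw [mem_Id] at hf
    rw [mem_Id_lam] at hf2
    rw [mem_kerOn, mem_Id]
    refine ⟨⟨rho_mem hf.1, fun i => ⟨?_, ?_⟩, fun i hi => ?_, fun l => ?_⟩, ?_⟩
    · exact hvan _ _ _ (hf.2.1 (Sum.inl i)).1
    · exact hvan _ _ _ (hf.2.1 (Sum.inl i)).2
    · have := hf.2.2.1 (Sum.inl i) trivial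
      rw [ddL_rho]
      have hi' : ¬ (i : ℕ) < e := not_lt.2 hi
      simpa [Xc, hi'] using this
    · exact hvan _ _ _ (hf.2.2.2 (Sum.inl l))
    · rintro (⟨i, j⟩ | l)
      · rw [evL_apply, eval_rho]
        refine Fin.cases ?_ (fun j => ?_) j
        · exact (hf2.2.1 i).1.right
        · obtain rfl : j = 0 := Subsingleton.elim _ _
          exact (hf2.2.1 i).2.right
      · rw [evL_apply, eval_rho]
        exact (hf2.2.2.2 l).left
  let T : Id (Hm k (N+1) (d+2)) Set.univ Xc →ₗ[k] kerOn W (fun j => evL (pts j Y)) :=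
    (rho.toLinearMap.comp (Submodule.subtype _)).codRestrict _ (fun f => htr f f.2)
  have hinj : Function.Injective T := by
    rw [← LinearMap.ker_eq_bot, eq_bot_iff]
    rintro ⟨f, hf⟩ hfT
    have h0 : rho f = 0 := congrArg Subtype.val (LinearMap.mem_ker.1 hfT)
    obtain ⟨g, hg, rfl⟩ := rho_ker (Id_le _ _ _ hf) h0
    have h1 := div_mem hYN hg (hmem _ hf)
    have h2 : g ∈ Id M' Set.univ (lam Y) := by
      rw [mem_Id] at h1 ⊢
      refine ⟨mem_kerOn.2 ⟨hg, fun j => ?_⟩, h1.2⟩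
      rw [mem_Id] at hf
      have h3 := hf.2.2.1 (Sum.inl (Fin.castLE hez j)) trivial
      rw [ddL_X0_mul] at h3
      simpa [Xc] using h3
    have : FiniteDimensional k (Id M' Set.univ (lam Y)) := Submodule.finiteDimensional_of_le (Id_le _ _ _)
    have h3 := finrank_le_zero_mem hY3 h2
    subst h3
    simp
  have : FiniteDimensional k (kerOn W (fun j => evL (pts j Y))) := Submodule.finiteDimensional_of_le (kerOn_le _ _)
  have h5 := LinearMap.finrank_le_finrank_of_injective hinj
  omega

end PartD
end S15


namespace S15
section PartE
variable {k : Type} [Field k]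

/-- the quadric -/
noncomputable def Qd (k : Type) [Field k] : MvPolynomial (Fin 4) k := X 0 * X 3 - X 1 * X 2

lemma Qd_mem : Qd k ∈ Hm k 4 2 := by
  have h1 := (isHomogeneous_X k (0 : Fin 4)).mul (isHomogeneous_X k (3 : Fin 4))
  have h2 := (isHomogeneous_X k (1 : Fin 4)).mul (isHomogeneous_X k (2 : Fin 4))
  exact Submodule.sub_mem _ h1 h2

lemma eval_Qd (p : Fin 4 → k) : eval p (Qd k) = p 0 * p 3 - p 1 * p 2 := by simp [Qd]

/-- points of the quadric -/
def Seg (s t : k) : Fin 4 → k := ![1, s, t, s * t]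

lemma rho_Qd_ne : rho (Qd k) ≠ 0 := by
  have h : rho (Qd k) = - (X 0 * X 1) := by
    simp only [rho, Qd, map_sub, map_mul, aeval_X]
    rw [show (3 : Fin 4) = Fin.succ 2 from rfl, show (1 : Fin 4) = Fin.succ 0 from rfl,
      show (2 : Fin 4) = Fin.succ 1 from rfl]
    simp only [Fin.cons_zero, Fin.cons_succ]
    ring
  rw [h, neg_ne_zero]
  exact mul_ne_zero (X_ne_zero _) (X_ne_zero _)

lemma Qd_dvd_of_X0_mul {f : MvPolynomial (Fin 4) k} (h : Qd k ∣ X 0 * f) : Qd k ∣ f := by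
  obtain ⟨g, hg⟩ := h
  have h1 : rho (Qd k) * rho g = 0 := by
    rw [← map_mul, ← hg, map_mul]
    simp [rho]
  have h2 : rho g = 0 := (mul_eq_zero.1 h1).resolve_left rho_Qd_ne
  have h3 := X0_dvd_sub g
  rw [h2, map_zero, sub_zero] at h3
  obtain ⟨g', rfl⟩ := h3
  refine ⟨g', ?_⟩
  have : X 0 * f = X 0 * (Qd k * g') := by rw [hg]; ring
  exact mul_left_cancel₀ (X_ne_zero _) this

lemma Qd_dvd_of_pow {f : MvPolynomial (Fin 4) k} (n : ℕ) (h : Qd k ∣ X 0 ^ n * f) : Qd k ∣ f := by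
  induction n with
  | zero => simpa using h
  | succ n ih => 
    refine ih (Qd_dvd_of_X0_mul ?_)
    rwa [← mul_assoc, ← pow_succ']

lemma aeval_dvd_sub {A : Type*} [CommRing A] [Algebra k A] (q : A) {n : ℕ} (a b : Fin n → A)
    (h : ∀ i, q ∣ a i - b i) (f : MvPolynomial (Fin n) k) : q ∣ aeval a f - aeval b f := by
  induction f using MvPolynomial.induction_on with
  | C c => simp
  | add f g hf hg =>
    simp only [map_add]
    have := dvd_add hf hg
    convert this using 1
    ring
  | mul_X f i hf =>
    simp only [map_mul, aeval_X]
    have e : aeval a f * a i - aeval b f * b i = (aeval a f - aeval b f) * a i + aeval b f * (a i - b i) := by ring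
    rw [e]
    exact dvd_add (Dvd.dvd.mul_right hf _) (Dvd.dvd.mul_left (h i) _)

lemma aeval_smul_X [Infinite k] {N d : ℕ} {f : MvPolynomial (Fin N) k} (hf : f ∈ Hm k N d) (q : MvPolynomial (Fin N) k) :
    aeval (fun i => q * X i) f = q ^ d * f := by
  refine MvPolynomial.funext fun p => ?_
  have h : (aeval p : MvPolynomial (Fin N) k →ₐ[k] k).comp (aeval (fun i => q * X i)) =
      (aeval (eval p q • p) : MvPolynomial (Fin N) k →ₐ[k] k) := by
    ext i
    simp [aeval_eq_eval]
  have h1 : eval p (aeval (fun i => q * X i) f) = eval (eval p q • p) f := by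
    have := DFunLike.congr_fun h f
    simpa [aeval_eq_eval] using this
  rw [h1, eval_smul hf, map_mul, map_pow]

lemma Qd_dvd [Infinite k] {d : ℕ} {f : MvPolynomial (Fin 4) k} (hf : f ∈ Hm k 4 d)
    (h : ∀ s t, eval (Seg s t) f = 0) : Qd k ∣ f := by
  refine Qd_dvd_of_pow d ?_
  have h1 := aeval_dvd_sub (k := k) (Qd k) (fun i : Fin 4 => X 0 * X i) ![X 0 * X 0, X 0 * X 1, X 0 * X 2, X 1 * X 2] (by
    intro i
    fin_cases i <;> simp [Qd]) f
  rw [aeval_smul_X hf] at h1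
  have h2 : X 0 * aeval ![X 0 * X 0, X 0 * X 1, X 0 * X 2, X 1 * X 2] f = (0 : MvPolynomial (Fin 4) k) := by
    refine MvPolynomial.funext fun p => ?_
    have e1 : eval p (aeval ![X 0 * X 0, X 0 * X 1, X 0 * X 2, X 1 * X 2] f : MvPolynomial (Fin 4) k) =
        eval ![p 0 * p 0, p 0 * p 1, p 0 * p 2, p 1 * p 2] f := by
      have h : (aeval p : MvPolynomial (Fin 4) k →ₐ[k] k).comp (aeval ![X 0 * X 0, X 0 * X 1, X 0 * X 2, X 1 * X 2]) =
          (aeval ![p 0 * p 0, p 0 * p 1, p 0 * p 2, p 1 * p 2] : MvPolynomial (Fin 4) k →ₐ[k] k) := by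
        ext i
        fin_cases i <;> simp
      have := DFunLike.congr_fun h f
      simpa [aeval_eq_eval] using this
    rw [map_mul, eval_X, e1, map_zero]
    by_cases hp : p 0 = 0
    · rw [hp, zero_mul]
    · have : ![p 0 * p 0, p 0 * p 1, p 0 * p 2, p 1 * p 2] = (p 0 * p 0) • Seg (p 1 / p 0) (p 2 / p 0) := by
        funext i
        fin_cases i <;> simp [Seg] <;> field_simp
      rw [this, eval_smul hf, h, mul_zero, mul_zero]
  have h3 := (mul_eq_zero.1 h2).resolve_left (X_ne_zero _)
  rw [h3, sub_zero] at h1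
  exact h1

lemma Qd_factor [Infinite k] {d : ℕ} {f : MvPolynomial (Fin 4) k} (hf : f ∈ Hm k 4 (d+2))
    (h : ∀ s t, eval (Seg s t) f = 0) : ∃ g ∈ Hm k 4 d, f = Qd k * g := by
  obtain ⟨g, hg⟩ := Qd_dvd hf h
  refine ⟨homogeneousComponent d g, homogeneousComponent_mem d g, ?_⟩
  have h1 : homogeneousComponent (d+2) f = f := homogeneousComponent_eq_self hf
  rw [← h1, hg]
  conv_lhs => rw [← sum_homogeneousComponent g, Finset.mul_sum, map_sum]
  have h2 : ∀ i, homogeneousComponent (d+2) (Qd k * homogeneousComponent i g) = if i = d then Qd k * homogeneousComponent i g else 0 := by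
    intro i
    have h3 : Qd k * homogeneousComponent i g ∈ homogeneousSubmodule (Fin 4) k (2 + i) :=
      IsHomogeneous.mul Qd_mem (homogeneousComponent_isHomogeneous i g)
    rw [homogeneousComponent_of_mem h3]
    refine if_congr ?_ rfl rfl
    omega
  simp only [h2]
  rw [Finset.sum_ite_eq']
  split_ifs with h4
  · rfl
  · rw [homogeneousComponent_eq_zero, mul_zero]
    simp at h4
    omega

/-- the trace on the quadric -/
noncomputable def tr : MvPolynomial (Fin 4) k →ₐ[k] Polynomial (Polynomial k) :=
  aeval ![1, Polynomial.C Polynomial.X, Polynomial.X, Polynomial.C Polynomial.X * Polynomial.X]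

lemma tr_eval (s t : k) (f : MvPolynomial (Fin 4) k) : ((tr f).eval (Polynomial.C t)).eval s = eval (Seg s t) f := by
  induction f using MvPolynomial.induction_on with
  | C c => 
    have : tr (C c : MvPolynomial (Fin 4) k) = Polynomial.C (Polynomial.C c) := by
      rw [tr, ← algebraMap_eq, AlgHom.commutes]; rfl
    simp [this]
  | add f g hf hg => simp only [map_add, Polynomial.eval_add, hf, hg]
  | mul_X f i hf =>
    simp only [map_mul, Polynomial.eval_mul, hf, eval_X]
    congr 1
    fin_cases i <;> simp [tr, Seg]
    ring

lemma tr_bound {D : ℕ} {f : MvPolynomial (Fin 4) k} (hf : f ∈ Hm k 4 D) (j : ℕ) :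
    (tr f).coeff j ∈ Polynomial.degreeLT k (D+1) ∧ (D < j → (tr f).coeff j = 0) := by
  rw [mem_homogeneousSubmodule] at hf
  rw [f.as_sum, map_sum, Polynomial.finsetSum_coeff]
  have hm : ∀ m ∈ f.support, (tr (monomial m (coeff m f))).coeff j = 
      if j = m 2 + m 3 then Polynomial.monomial (m 1 + m 3) (coeff m f) else 0 := by
    intro m _
    have : tr (monomial m (coeff m f)) = Polynomial.monomial (m 2 + m 3) (Polynomial.monomial (m 1 + m 3) (coeff m f)) := by
      rw [tr, aeval_monomial, Finsupp.prod_fintype _ _ (by simp)]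
      simp only [Fin.prod_univ_four, Matrix.cons_val]
      rw [← Polynomial.C_mul_X_pow_eq_monomial, ← Polynomial.C_mul_X_pow_eq_monomial]
      have : algebraMap k (Polynomial (Polynomial k)) (coeff m f) = Polynomial.C (Polynomial.C (coeff m f)) := rfl
      rw [this, Polynomial.C_mul, Polynomial.C_pow]
      ring
    rw [this, Polynomial.coeff_monomial]
    simp [eq_comm]
  rw [Finset.sum_congr rfl hm]
  have hdeg : ∀ m ∈ f.support, m 0 + m 1 + m 2 + m 3 = D := by
    intro m hm
    have h1 : m.degree = D := (IsHomogeneous.degree_eq_sum_deg_support hf hm).symm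
    rw [Finsupp.degree_eq_sum, Fin.sum_univ_four] at h1
    exact h1
  constructor
  · refine Submodule.sum_mem _ fun m hm => ?_
    have := hdeg m hm
    split_ifs
    · rw [Polynomial.mem_degreeLT]
      refine lt_of_le_of_lt (Polynomial.degree_monomial_le _ _) ?_
      exact_mod_cast (by omega : m 1 + m 3 < D + 1)
    · exact Submodule.zero_mem _
  · intro hj
    refine Finset.sum_eq_zero fun m hm => ?_
    have := hdeg m hm
    rw [if_neg (by omega)]

end PartE
end S15


namespace S15
section PartF
variable {k : Type} [Field k]

/-- parameter space for pairs of points on the quadric -/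
abbrev Prs (k : Type) (y : ℕ) := Fin y → Fin 2 → Fin 2 → k

/-- secant lines of the quadric -/
def secs {y : ℕ} (p : Prs k y) : Cfg k 4 (Fin 0) (Fin y) :=
  (fun i => i.elim0, fun l j => Seg (p l j 0) (p l j 1))

lemma exists_two_roots [IsAlgClosed k] [CharZero k] {a b c : k} (ha : a ≠ 0) (hd : b * b - 4 * a * c ≠ 0) :
    ∃ x y : k, x ≠ y ∧ a * (x * x) + b * x + c = 0 ∧ a * (y * y) + b * y + c = 0 := by
  obtain ⟨z, hz⟩ := IsAlgClosed.exists_pow_nat_eq (b * b - 4 * a * c) (n := 2) (by norm_num)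
  have hz0 : z ≠ 0 := by
    rintro rfl
    apply hd
    rw [← hz]; ring
  refine ⟨(-b + z) / (2 * a), (-b - z) / (2 * a), ?_, ?_, ?_⟩
  · intro h
    field_simp at h
    have : 2 * z = 0 := by linear_combination h
    simp [hz0] at this
  · field_simp
    linear_combination hz
  · field_simp
    linear_combination hz

lemma seg_of_zero {p : Fin 4 → k} (h0 : p 0 ≠ 0) (hq : p 0 * p 3 - p 1 * p 2 = 0) :
    p = p 0 • Seg (p 1 / p 0) (p 2 / p 0) := by
  funext i
  fin_cases i
  · simp [Seg]
  · simp [Seg]; field_simp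
  · simp [Seg]; field_simp
  · simp [Seg]; field_simp; linear_combination hq

lemma vanL_smul {N : ℕ} {f : MvPolynomial (Fin N) k} {a b : Fin N → k} (h : vanL f a b) (c c' : k) :
    vanL f (c • a) (c' • b) := by
  intro s t
  rw [smul_smul, smul_smul]
  exact h _ _

/-- the quadratic form -/
def qf (p : Fin 4 → k) : k := p 0 * p 3 - p 1 * p 2

lemma exists_secant [IsAlgClosed k] [CharZero k] (a b : Fin 4 → k) (h1 : qf b ≠ 0)
    (h2 : (a 0 * b 3 + b 0 * a 3 - a 1 * b 2 - b 1 * a 2) * (a 0 * b 3 + b 0 * a 3 - a 1 * b 2 - b 1 * a 2) - 4 * qf b * qf a ≠ 0)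
    (h3 : qf (b 0 • a - a 0 • b) ≠ 0) : ∃ q : Fin 2 → Fin 2 → k, ∀ f : MvPolynomial (Fin 4) k,
      vanL f (Seg (q 0 0) (q 0 1)) (Seg (q 1 0) (q 1 1)) → vanL f a b := by
  obtain ⟨x, y, hxy, hx, hy⟩ := exists_two_roots h1 h2
  have key : ∀ x : k, qf b * (x * x) + (a 0 * b 3 + b 0 * a 3 - a 1 * b 2 - b 1 * a 2) * x + qf a = 0 →
      ∃ c q0 q1 : k, a + x • b = c • Seg q0 q1 := by
    intro x hx
    have hq : qf (a + x • b) = 0 := by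
      simp only [qf, Pi.add_apply, Pi.smul_apply, smul_eq_mul] at hx ⊢
      linear_combination hx
    have h0 : (a + x • b) 0 ≠ 0 := by
      intro h0
      apply h3
      have h0' : a 0 = - (x * b 0) := by
        simp only [Pi.add_apply, Pi.smul_apply, smul_eq_mul] at h0
        linear_combination h0
      have : b 0 • a - a 0 • b = b 0 • (a + x • b) := by
        rw [h0']; module
      rw [this]
      simp only [qf, Pi.smul_apply, smul_eq_mul] at hq ⊢
      linear_combination (b 0 * b 0) * hq
    exact ⟨_, _, _, seg_of_zero h0 hq⟩
  obtain ⟨c1, q1, q2, e1⟩ := key x hx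
  obtain ⟨c2, q3, q4, e2⟩ := key y hy
  refine ⟨![![q1, q2], ![q3, q4]], fun f hf s t => ?_⟩
  have hf' : vanL f (a + x • b) (a + y • b) := by
    rw [e1, e2]
    exact vanL_smul hf _ _
  have hxy' : x - y ≠ 0 := sub_ne_zero.2 hxy
  have := hf' ((t - s * y) / (x - y)) ((s * x - t) / (x - y))
  have e3 : (t - s * y) / (x - y) + (s * x - t) / (x - y) = s := by field_simp; ring
  have e4 : (t - s * y) / (x - y) * x + (s * x - t) / (x - y) * y = t := by field_simp; ring
  have e5 : s • a + t • b = ((t - s * y) / (x - y)) • (a + x • b) + ((s * x - t) / (x - y)) • (a + y • b) := by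
    generalize (t - s * y) / (x - y) = c1 at *
    generalize (s * x - t) / (x - y) = c2 at *
    rw [← e3, ← e4]
    module
  rw [e5]
  exact this

lemma exists_secs [IsAlgClosed k] [CharZero k] {d y r : ℕ} (h : Good k 4 d 0 y r) :
    ∃ p : Prs k y, Module.finrank k (Id (Hm k 4 d) Set.univ (secs p)) ≤ r := by
  let F : Fin y → Cfg k 4 (Fin 0) (Fin y) → k := fun l C => qf (C.2 l 1) *
    ((C.2 l 0 0 * C.2 l 1 3 + C.2 l 1 0 * C.2 l 0 3 - C.2 l 0 1 * C.2 l 1 2 - C.2 l 1 1 * C.2 l 0 2) *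
      (C.2 l 0 0 * C.2 l 1 3 + C.2 l 1 0 * C.2 l 0 3 - C.2 l 0 1 * C.2 l 1 2 - C.2 l 1 1 * C.2 l 0 2) -
      4 * qf (C.2 l 1) * qf (C.2 l 0)) * qf (C.2 l 1 0 • C.2 l 0 - C.2 l 0 0 • C.2 l 1)
  have o1 := lineOpen_Id (k := k) (ι := Fin 0) (κ := Fin y) (Hm k 4 d) Set.univ r
  have o2 : LineOpen (k := k) {C | ∀ l, F l C ≠ 0} := lineOpen_forall_ne F fun l p v => by
    have hc : ∀ i j, PolyFn (fun e : k => (p + e • v).2 l i j) := fun i j => by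
      simpa using PolyFn.affine (p.2 l i j) (v.2 l i j)
    have hs : ∀ j, PolyFn (fun e : k => ((p + e • v).2 l 1 0 • (p + e • v).2 l 0 - (p + e • v).2 l 0 0 • (p + e • v).2 l 1) j) := fun j => 
      ((hc 1 0).mul (hc 0 j)).sub ((hc 0 0).mul (hc 1 j))
    have hqf : ∀ {g : k → Fin 4 → k}, (∀ j, PolyFn (fun e => g e j)) → PolyFn (fun e => qf (g e)) := fun hg =>
      ((hg 0).mul (hg 3)).sub ((hg 1).mul (hg 2))
    refine PolyFn.mul (PolyFn.mul (hqf (hc 1)) (PolyFn.sub (PolyFn.mul ?_ ?_) (((PolyFn.const _).mul (hqf (hc 1))).mul (hqf (hc 0))))) (hqf hs)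
    all_goals repeat' first | exact hc _ _ | exact PolyFn.const _ | apply PolyFn.sub | apply PolyFn.mul | apply PolyFn.add
  have n2 : {C | ∀ l, F l C ≠ 0}.Nonempty := by
    refine ⟨(fun _ _ _ => 0, fun _ => ![![0, 1, 1, 0], ![1, 0, 0, 1]]), fun l => ?_⟩
    simp [F, qf]
  obtain ⟨C, c1, c2⟩ := o1.inter_nonempty o2 h n2
  have hp : ∀ l, ∃ q : Fin 2 → Fin 2 → k, ∀ f : MvPolynomial (Fin 4) k,
      vanL f (Seg (q 0 0) (q 0 1)) (Seg (q 1 0) (q 1 1)) → vanL f (C.2 l 0) (C.2 l 1) := by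
    intro l
    have := c2 l
    simp only [F, ne_eq, mul_eq_zero, not_or] at this
    exact exists_secant _ _ this.1.1 this.1.2 this.2
  choose p hp using hp
  refine ⟨p, le_trans ?_ c1⟩
  have := finId (d := d) Set.univ C
  refine finrank_mono' fun f hf => ?_
  rw [mem_Id] at hf ⊢
  exact ⟨hf.1, fun i => i.elim0, fun i => i.elim0, fun l => hp l f (hf.2.2.2 l)⟩

lemma PolyFn.polyEval {g : k → k} (hg : PolyFn g) (q : Polynomial k) : PolyFn (fun e => q.eval (g e)) := by
  obtain ⟨p, hp⟩ := hg
  exact ⟨q.comp p, by simp [hp]⟩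

/-- quotients of traces -/
abbrev Kq (k : Type) [Field k] (D n : ℕ) := Fin (D+1) → Polynomial.degreeLT k n

instance finLT (n : ℕ) : FiniteDimensional k (Polynomial.degreeLT k n) :=
  Module.Finite.equiv (Polynomial.degreeLTEquiv k n).symm

lemma finrank_Kq (D n : ℕ) : Module.finrank k (Kq k D n) = (D+1) * n := by
  rw [Module.finrank_pi_fintype]
  simp [(Polynomial.degreeLTEquiv k n).finrank_eq]

/-- evaluation -/
noncomputable def eps {D n : ℕ} (q : Fin 2 → k) : Kq k D n →ₗ[k] k :=
  ∑ j : Fin (D+1), (q 1) ^ (j : ℕ) • ((Polynomial.leval (q 0)).comp ((Submodule.subtype _).comp (LinearMap.proj j)))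

lemma eps_apply {D n : ℕ} (q : Fin 2 → k) (h : Kq k D n) :
    eps q h = ∑ j : Fin (D+1), (q 1) ^ (j : ℕ) * (h j : Polynomial k).eval (q 0) := by
  simp [eps]

lemma eps_sep [Infinite k] {D n : ℕ} (h : Kq k D n) (h0 : h ≠ 0) : ∃ q : Fin 2 → k, eps q h ≠ 0 := by
  by_contra hcon
  simp only [not_exists, not_not] at hcon
  apply h0
  funext j
  apply Subtype.ext
  refine Polynomial.funext fun s => ?_
  have hp : (∑ j : Fin (D+1), Polynomial.monomial (j : ℕ) ((h j : Polynomial k).eval s)) = 0 := by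
    refine Polynomial.funext fun t => ?_
    have := hcon ![s, t]
    rw [eps_apply] at this
    rw [Polynomial.eval_finsetSum]
    simpa [Polynomial.eval_monomial, mul_comm] using this
  have := congrArg (fun p => Polynomial.coeff p (j : ℕ)) hp
  simp only [Polynomial.finsetSum_coeff, Polynomial.coeff_monomial, Polynomial.coeff_zero] at this
  rw [Finset.sum_eq_single j] at this
  · simpa using this
  · intro b _ hb
    rw [if_neg]
    intro h
    exact hb (Fin.ext h)
  · simp

lemma poly_factor {ν : Type*} [Fintype ν] (s : ν → k) (hs : Function.Injective s) {n : ℕ} {p : Polynomial k}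
    (hp : p ∈ Polynomial.degreeLT k n) (h : ∀ i, p.eval (s i) = 0) :
    ∃ q : Polynomial.degreeLT k (n - Fintype.card ν), p = (∏ i, (Polynomial.X - Polynomial.C (s i))) * q := by
  have h1 : (∏ i, (Polynomial.X - Polynomial.C (s i))) ∣ p := by
    refine Finset.prod_dvd_of_coprime (fun i _ j _ hij => Polynomial.pairwise_coprime_X_sub_C hs hij) fun i _ => ?_
    exact Polynomial.dvd_iff_isRoot.2 (h i)
  obtain ⟨q, rfl⟩ := h1
  refine ⟨⟨q, ?_⟩, rfl⟩
  by_cases hq : q = 0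
  · rw [hq]; exact Submodule.zero_mem _
  · have hm := Polynomial.monic_prod_X_sub_C s Finset.univ
    have hne : (∏ i, (Polynomial.X - Polynomial.C (s i))) * q ≠ 0 := mul_ne_zero hm.ne_zero hq
    rw [Polynomial.mem_degreeLT, Polynomial.degree_eq_natDegree hne] at hp
    rw [Polynomial.mem_degreeLT, Polynomial.degree_eq_natDegree hq]
    rw [Polynomial.natDegree_mul hm.ne_zero hq, Polynomial.natDegree_finsetProd_X_sub_C_eq_card, Finset.card_univ] at hp
    norm_cast at hp ⊢
    omega

lemma tr_factor [Infinite k] {ν : Type*} [Fintype ν] (s : ν → k) (hs : Function.Injective s) {D : ℕ}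
    {f : MvPolynomial (Fin 4) k} (hf : f ∈ Hm k 4 D) (h : ∀ i t, eval (Seg (s i) t) f = 0) :
    ∃ g : Kq k D (D + 1 - Fintype.card ν), ∀ q : Fin 2 → k,
      eval (Seg (q 0) (q 1)) f = (∏ i, (Polynomial.X - Polynomial.C (s i))).eval (q 0) * eps q g := by
  have h1 : ∀ j i, ((tr f).coeff j).eval (s i) = 0 := by
    intro j i
    have hz : (tr f).map (Polynomial.evalRingHom (s i)) = 0 := by
      refine Polynomial.funext fun t => ?_
      have := h i t
      rw [← tr_eval] at this
      rw [Polynomial.eval_zero, ← this, Polynomial.eval_map]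
      have h2 := Polynomial.hom_eval₂ (tr f) (RingHom.id _) (Polynomial.evalRingHom (s i)) (Polynomial.C t)
      simpa [Polynomial.eval₂_id] using h2.symm
    have := congrArg (fun p => Polynomial.coeff p j) hz
    simpa [Polynomial.coeff_map] using this
  choose g hg using fun j : Fin (D+1) => poly_factor s hs (tr_bound hf j).1 (h1 j)
  refine ⟨g, fun q => ?_⟩
  rw [← tr_eval, Polynomial.eval_eq_sum_range' (p := tr f) (x := Polynomial.C (q 1)) (n := D+1) (Nat.lt_succ_of_le (Polynomial.natDegree_le_iff_coeff_eq_zero.2 fun j hj => (tr_bound hf j).2 hj)), ← Fin.sum_univ_eq_sum_range (fun j => (tr f).coeff j * Polynomial.C (q 1) ^ j), Polynomial.eval_finsetSum, eps_apply,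
    Finset.mul_sum]
  · refine Finset.sum_congr rfl fun j _ => ?_
    rw [hg j, Polynomial.eval_mul, Polynomial.eval_mul, Polynomial.eval_pow, Polynomial.eval_C]
    ring

end PartF
end S15


namespace S15
section PartG
variable {k : Type} [Field k]

lemma polyV_seg {g h : k → k} (hg : PolyFn g) (hh : PolyFn h) : PolyV (fun e => Seg (g e) (h e)) := by
  intro i
  fin_cases i
  · exact PolyFn.const _
  · exact hg
  · exact hh
  · exact hg.mul hh

lemma exists_param [IsAlgClosed k] [CharZero k] {d y r0 D n : ℕ} (hy : Good k 4 d 0 y r0) :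
    ∃ p : Prs k y, Module.finrank k (Id (Hm k 4 d) Set.univ (secs p)) ≤ r0 ∧
      Module.finrank k (kerOn (⊤ : Submodule k (Kq k D n)) (fun j : Fin y × Fin 2 => eps (p j.1 j.2))) ≤ (D+1) * n - 2 * y ∧
      (∀ a b : Fin y × Fin 2, a ≠ b → p a.1 a.2 0 ≠ p b.1 b.2 0) ∧ ∀ l, p l 0 1 ≠ p l 1 1 := by
  have hc : ∀ (p v : Prs k y) l i j, PolyFn (fun e : k => (p + e • v) l i j) := fun p v l i j => by
    simpa using PolyFn.affine (p l i j) (v l i j)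
  have o1 : LineOpen (k := k) {p : Prs k y | Module.finrank k (Id (Hm k 4 d) Set.univ (secs p)) ≤ r0} := by
    intro p v e0 h
    exact Id_semicont (Hm k 4 d) Set.univ (fun e => secs (p + e • v)) (fun i => i.elim0)
      (fun l j => polyV_seg (hc p v l j 0) (hc p v l j 1)) r0 e0 h
  have n1 : {p : Prs k y | Module.finrank k (Id (Hm k 4 d) Set.univ (secs p)) ≤ r0}.Nonempty := exists_secs hy
  have o2 : LineOpen (k := k) {p : Prs k y | Module.finrank k (kerOn (⊤ : Submodule k (Kq k D n))
      (fun j : Fin y × Fin 2 => eps (p j.1 j.2))) ≤ (D+1) * n - 2 * y} := by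
    refine lineOpen_finrank (E := Prs k y) ⊤ (fun (j : Fin y × Fin 2) p => eps (p j.1 j.2)) (fun j p v f _ => ?_) _
    simp only [eps_apply]
    exact PolyFn.sum _ fun i _ => ((hc p v _ _ 1).pow _).mul ((hc p v _ _ 0).polyEval _)
  have n2 : {p : Prs k y | Module.finrank k (kerOn (⊤ : Submodule k (Kq k D n))
      (fun j : Fin y × Fin 2 => eps (p j.1 j.2))) ≤ (D+1) * n - 2 * y}.Nonempty := by
    obtain ⟨z, hz⟩ := exists_points (⊤ : Submodule k (Kq k D n)) (X := Fin 2 → k) eps (fun f _ h => eps_sep f h) 0 (y * 2)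
    refine ⟨fun l j => z (finProdFinEquiv (l, j)), ?_⟩
    have h1 : kerOn (⊤ : Submodule k (Kq k D n)) (fun j : Fin y × Fin 2 => eps (z (finProdFinEquiv (j.1, j.2)))) =
        kerOn ⊤ (fun i => eps (z i)) := by
      ext f
      rw [mem_kerOn, mem_kerOn]
      exact and_congr_right fun _ => finProdFinEquiv.forall_congr_right (q := fun i => eps (z i) f = 0)
    rw [Set.mem_ofPred_eq, h1]
    refine hz.trans ?_
    rw [finrank_top, finrank_Kq, mul_comm y 2]
  have o3 : LineOpen (k := k) {p : Prs k y | ∀ a : {a : (Fin y × Fin 2) × (Fin y × Fin 2) // a.1 ≠ a.2},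
      p a.1.1.1 a.1.1.2 0 - p a.1.2.1 a.1.2.2 0 ≠ 0} := by
    refine lineOpen_forall_ne _ fun a p v => (hc p v _ _ _).sub (hc p v _ _ _)
  have o4 : LineOpen (k := k) {p : Prs k y | ∀ l, p l 0 1 - p l 1 1 ≠ 0} := by
    refine lineOpen_forall_ne _ fun a p v => (hc p v _ _ _).sub (hc p v _ _ _)
  have n34 : ({p : Prs k y | ∀ a : {a : (Fin y × Fin 2) × (Fin y × Fin 2) // a.1 ≠ a.2},
      p a.1.1.1 a.1.1.2 0 - p a.1.2.1 a.1.2.2 0 ≠ 0} ∩ {p : Prs k y | ∀ l, p l 0 1 - p l 1 1 ≠ 0}).Nonempty := by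
    have key : ∀ a b : Fin y × Fin 2, a ≠ b → (((finProdFinEquiv a : Fin (y*2)) : ℕ) : k) - (((finProdFinEquiv b : Fin (y*2)) : ℕ) : k) ≠ 0 := by
      intro a b hab h
      rw [sub_eq_zero, Nat.cast_inj] at h
      exact hab (finProdFinEquiv.injective (Fin.ext h))
    refine ⟨fun l j _ => (((finProdFinEquiv (l, j) : Fin (y*2)) : ℕ) : k), fun a => key _ _ a.2, fun l => key (l, 0) (l, 1) (by simp)⟩
  obtain ⟨p, ⟨h1, h2⟩, h3, h4⟩ := (o1.inter o2).inter_nonempty (o3.inter o4) (o1.inter_nonempty o2 n1 n2) n34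
  exact ⟨p, h1, h2, fun a b hab => sub_ne_zero.1 (h3 ⟨(a, b), hab⟩), fun l => sub_ne_zero.1 (h4 l)⟩

/-- coefficient of the linear term after removing one root -/
lemma eps_of_dd {D n : ℕ} {ν : Type*} [Fintype ν] [DecidableEq ν] (s : ν → k) (hs : Function.Injective s)
    {f : MvPolynomial (Fin 4) k} (g : Kq k D n) [Infinite k]
    (hg : ∀ q : Fin 2 → k, eval (Seg (q 0) (q 1)) f = (∏ i, (Polynomial.X - Polynomial.C (s i))).eval (q 0) * eps q g)
    (i : ν) (t : k) (hd : ddL (Seg (s i) t) ![0, 1, 0, t] f = 0) : eps ![s i, t] g = 0 := by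
  let H : Polynomial k := ∑ j : Fin (D+1), Polynomial.C (t ^ (j : ℕ)) * (g j : Polynomial k)
  have hH : ∀ x, H.eval x = eps ![x, t] g := by
    intro x
    simp [H, eps_apply, Polynomial.eval_finsetSum]
  let Q : Polynomial k := ∏ j ∈ Finset.univ.erase i, (Polynomial.X - Polynomial.C (s j))
  have hQ : (∏ i, (Polynomial.X - Polynomial.C (s i))) = (Polynomial.X - Polynomial.C (s i)) * Q :=
    (Finset.mul_prod_erase _ _ (Finset.mem_univ i)).symm
  have hlp : lp (Seg (s i) t) ![0, 1, 0, t] f = Polynomial.X * (Q * H).comp (Polynomial.X + Polynomial.C (s i)) := by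
    refine Polynomial.funext fun e => ?_
    have e1 : Seg (s i) t + e • ![0, 1, 0, t] = Seg (s i + e) t := by
      funext j
      fin_cases j <;> simp [Seg]
      ring
    have h2 := hg ![s i + e, t]
    simp only [Matrix.cons_val_zero, Matrix.cons_val_one] at h2
    rw [lp_eval, e1, h2, hQ, ← hH]
    simp only [Polynomial.eval_mul, Polynomial.eval_comp, Polynomial.eval_add, Polynomial.eval_X, Polynomial.eval_C, Polynomial.eval_sub]
    rw [add_comm e]
    ring
  rw [← lp_coeff_one, hlp, Polynomial.coeff_X_mul, Polynomial.coeff_zero_eq_eval_zero] at hd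
  simp only [Polynomial.eval_mul, Polynomial.eval_comp, Polynomial.eval_add, Polynomial.eval_X, Polynomial.eval_C, zero_add, mul_eq_zero] at hd
  rw [← hH]
  refine hd.resolve_left ?_
  rw [← ne_eq, Polynomial.eval_prod, Finset.prod_ne_zero_iff]
  intro j hj
  simp only [Polynomial.eval_sub, Polynomial.eval_X, Polynomial.eval_C]
  exact sub_ne_zero.2 fun h => (Finset.ne_of_mem_erase hj) (hs h).symm

lemma qd_secant [CharZero k] {g : MvPolynomial (Fin 4) k} {s1 t1 s2 t2 : k} (hs : s1 ≠ s2) (ht : t1 ≠ t2)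
    (h : vanL (Qd k * g) (Seg s1 t1) (Seg s2 t2)) : vanL g (Seg s1 t1) (Seg s2 t2) := by
  have h1 : ∀ s t : k, s ≠ 0 → t ≠ 0 → eval (s • Seg s1 t1 + t • Seg s2 t2) g = 0 := by
    intro s t hs0 ht0
    have := h s t
    rw [map_mul, eval_Qd] at this
    refine (mul_eq_zero.1 this).resolve_left ?_
    have e : (s • Seg s1 t1 + t • Seg s2 t2) 0 * (s • Seg s1 t1 + t • Seg s2 t2) 3 -
      (s • Seg s1 t1 + t • Seg s2 t2) 1 * (s • Seg s1 t1 + t • Seg s2 t2) 2 = s * t * ((s1 - s2) * (t1 - t2)) := by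
      simp [Seg]
      ring
    rw [e]
    exact mul_ne_zero (mul_ne_zero hs0 ht0) (mul_ne_zero (sub_ne_zero.2 hs) (sub_ne_zero.2 ht))
  have h2 : ∀ s t : k, t ≠ 0 → eval (s • Seg s1 t1 + t • Seg s2 t2) g = 0 := by
    intro s t ht0
    by_cases hs0 : s = 0
    · subst hs0
      refine PolyFn.eq_zero_of_ne (g := fun s => eval (s • Seg s1 t1 + t • Seg s2 t2) g) ?_ 0 fun s hs => h1 s t hs ht0
      exact PolyFn.mvEval (fun i => (PolyFn.id'.mul (PolyFn.const _)).add (PolyFn.const _)) g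
    · exact h1 s t hs0 ht0
  intro s t
  by_cases ht0 : t = 0
  · subst ht0
    refine PolyFn.eq_zero_of_ne (g := fun t => eval (s • Seg s1 t1 + t • Seg s2 t2) g) ?_ 0 fun t ht => h2 s t ht
    exact PolyFn.mvEval (fun i => (PolyFn.const _).add (PolyFn.id'.mul (PolyFn.const _))) g
  · exact h2 s t ht0

/-- abstract rank bound -/
lemma rank_bound {R W : Type*} [AddCommGroup R] [Module k R] [AddCommGroup W] [Module k W]
    (I J : Submodule k R) (W' : Submodule k W) [FiniteDimensional k I] [FiniteDimensional k J] [FiniteDimensional k W']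
    (T : R →ₗ[k] W) (h1 : ∀ f ∈ I, T f ∈ W') (h2 : ∀ f ∈ I, T f = 0 → f ∈ J) :
    Module.finrank k I ≤ Module.finrank k J + Module.finrank k W' := by
  have h := (T.domRestrict I).finrank_range_add_finrank_ker
  have a1 : Module.finrank k (LinearMap.range (T.domRestrict I)) ≤ Module.finrank k W' := by
    refine finrank_mono' ?_
    rintro _ ⟨x, rfl⟩
    exact h1 _ x.2
  have a2 : Module.finrank k (LinearMap.ker (T.domRestrict I)) ≤ Module.finrank k J := by
    have : (LinearMap.ker (T.domRestrict I)).map I.subtype ≤ J := by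
      rintro _ ⟨x, hx, rfl⟩
      exact h2 _ x.2 hx
    calc _ = Module.finrank k ((LinearMap.ker (T.domRestrict I)).map I.subtype) :=
          (LinearEquiv.finrank_eq (Submodule.equivMapOfInjective _ I.injective_subtype _))
      _ ≤ _ := finrank_mono' this
  omega

lemma quad_step [IsAlgClosed k] [CharZero k] {d y r0 e m : ℕ} (hy : Good k 4 d 0 y r0) (he1 : e ≤ m) (he2 : e ≤ y) :
    Good k 4 (d+2) e (y + m - 2 * e) (r0 + ((d+3) * (d+3-m) - 2 * y)) := by
  classical
  let ν := Fin e ⊕ Fin (m - e)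
  have hν : Fintype.card ν = m := by simp [ν]; omega
  obtain ⟨p, p1, p2, p3, p4⟩ := exists_param (D := d+2) (n := d+2+1 - Fintype.card ν) hy
  let ie : Fin e → Fin y := Fin.castLE he2
  have hfin : (Set.range fun a : Fin y × Fin 2 => p a.1 a.2 0).Finite := Set.finite_range _
  have hinf := hfin.infinite_compl
  let em := hinf.natEmbedding
  let σ : ν → k := Sum.elim (fun i => p (ie i) 0 0) (fun j => (em (j : ℕ) : k))
  have hem : ∀ (j : ℕ) (a : Fin y × Fin 2), (em j : k) ≠ p a.1 a.2 0 := fun j a h => (em j).2 ⟨a, h.symm⟩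
  have hσ : Function.Injective σ := by
    rintro (i | i) (j | j) h
    · by_contra hne
      have : ((ie i, 0) : Fin y × Fin 2) ≠ (ie j, 0) := by
        intro h
        apply hne
        simp [ie] at h
        rw [h]
      exact p3 _ _ this h
    · exact absurd h.symm (hem j (ie i, 0))
    · exact absurd h (hem i (ie j, 0))
    · have h' : (em (i : ℕ) : k) = em (j : ℕ) := h
      have := em.injective (Subtype.ext h')
      rw [Fin.ext this]
  let A : Fin y → Fin 4 → k := fun l => Seg (p l 0 0) (p l 0 1)
  let B : Fin y → Fin 4 → k := fun l => Seg (p l 1 0) (p l 1 1)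
  let je : Fin (y - e) → Fin y := fun j => ⟨e + j, by have := j.2; omega⟩
  let C : Cfg k 4 (Fin e) (Fin (y - e) ⊕ Fin (m - e)) :=
    (fun i => ![A (ie i), ![0, 0, 1, p (ie i) 0 0], B (ie i), ![0, 1, 0, p (ie i) 0 1]],
      Sum.elim (fun j => ![A (je j), B (je j)]) (fun j => ![![1, em (j : ℕ), 0, 0], ![0, 0, 1, em (j : ℕ)]]))
  refine good_of (by simp) (by simp; omega) C ?_
  have hAB : ∀ f ∈ Id (Hm k 4 (d+2)) Set.univ C, ∀ l, vanL f (A l) (B l) := by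
    intro f hf l
    rw [mem_Id] at hf
    by_cases hl : (l : ℕ) < e
    · have := (hf.2.1 ⟨l, hl⟩).2
      simpa [C, ie] using this
    · have hl2 := l.2
      have := hf.2.2.2 (Sum.inl ⟨l - e, by omega⟩)
      have e1 : je ⟨l - e, by omega⟩ = l := Fin.ext (by simp [je]; omega)
      simpa [C, e1] using this
  let S := kerOn (⊤ : Submodule k (Kq k (d+2) (d+2+1 - Fintype.card ν))) (fun j : Fin y × Fin 2 => eps (p j.1 j.2))
  let μ : Kq k (d+2) (d+2+1 - Fintype.card ν) →ₗ[k] ((Fin 2 → k) → k) :=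
    LinearMap.pi fun q => ((∏ i, (Polynomial.X - Polynomial.C (σ i))).eval (q 0)) • eps q
  let T : MvPolynomial (Fin 4) k →ₗ[k] ((Fin 2 → k) → k) := LinearMap.pi fun q => evL (Seg (q 0) (q 1))
  have := finId (d := d+2) Set.univ C
  have := finId (d := d) Set.univ (secs p)
  have rb := rank_bound (Id (Hm k 4 (d+2)) Set.univ C) ((Id (Hm k 4 d) Set.univ (secs p)).map (LinearMap.mulLeft k (Qd k)))
    (S.map μ) T ?_ ?_
  · have b1 := Submodule.finrank_map_le μ S
    have b2 := Submodule.finrank_map_le (LinearMap.mulLeft k (Qd k)) (Id (Hm k 4 d) Set.univ (secs p))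
    have b3 : Module.finrank k S ≤ (d+3) * (d+3-m) - 2 * y := by
      refine le_trans p2 (le_of_eq ?_)
      rw [hν]
    omega
  · intro f hf
    have hab := hAB f hf
    have hf' := hf
    rw [mem_Id] at hf
    have hz : ∀ i t, eval (Seg (σ i) t) f = 0 := by
      rintro (i | j) t
      · have := (hf.2.1 i).1 1 (t - p (ie i) 0 1)
        convert this using 3
        funext l
        fin_cases l <;> simp [C, A, σ, Seg]
        ring
      · have := hf.2.2.2 (Sum.inr j) 1 t
        convert this using 3
        funext l
        fin_cases l <;> simp [C, σ, Seg]
        ring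
    obtain ⟨g, hg⟩ := tr_factor σ hσ hf.1 hz
    have hprod : ∀ x, (∀ i, x ≠ σ i) → (∏ i, (Polynomial.X - Polynomial.C (σ i))).eval x ≠ 0 := by
      intro x hx
      rw [Polynomial.eval_prod, Finset.prod_ne_zero_iff]
      intro j _
      simp only [Polynomial.eval_sub, Polynomial.eval_X, Polynomial.eval_C]
      exact sub_ne_zero.2 (hx j)
    refine ⟨g, mem_kerOn.2 ⟨trivial, ?_⟩, funext fun q => ?_⟩
    · rintro ⟨l, j⟩
      by_cases hl : (l : ℕ) < e ∧ j = 0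
      · obtain ⟨hl, rfl⟩ := hl
        have hd := hf.2.2.1 ⟨l, hl⟩ trivial
        have := eps_of_dd σ hσ g hg (Sum.inl ⟨l, hl⟩) (p l 0 1) (by simpa [C, ie, A, σ] using hd)
        have e1 : p l 0 = ![σ (Sum.inl ⟨l, hl⟩), p l 0 1] := by
          funext i
          fin_cases i <;> simp [σ, ie]
        change eps (p l 0) g = 0
        rw [e1]
        exact this
      · have h0 : eval (Seg (p l j 0) (p l j 1)) f = 0 := by
          have := hab l
          fin_cases j
          · exact this.left
          · exact this.right
        rw [hg (p l j)] at h0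
        refine (mul_eq_zero.1 h0).resolve_left (hprod _ ?_)
        rintro (i | i)
        · refine p3 (l, j) (ie i, 0) fun h => hl ?_
          rw [Prod.mk.injEq] at h
          refine ⟨?_, h.2⟩
          rw [h.1]
          exact i.2
        · exact (hem i (l, j)).symm
    · simp [μ, T, hg q]
  · intro f hf hTf
    have hz : ∀ s t, eval (Seg s t) f = 0 := fun s t => by simpa [T] using congrFun hTf ![s, t]
    obtain ⟨g, hg, rfl⟩ := Qd_factor (hf := Id_le _ _ _ hf) hz
    refine ⟨g, ?_, rfl⟩
    rw [SetLike.mem_coe, mem_Id]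
    refine ⟨hg, fun i => i.elim0, fun i => i.elim0, fun l => ?_⟩
    exact qd_secant (p3 (l, 0) (l, 1) (by simp)) (p4 l) (hAB _ hf l)

end PartG
end S15


namespace S15
section PartH
variable {k : Type} [Field k]

lemma sep_Hm [Infinite k] {N : ℕ} (f : MvPolynomial (Fin N) k) (h : f ≠ 0) : ∃ x : Fin N → k, evL x f ≠ 0 := by
  by_contra hcon
  simp only [not_exists, not_not, evL_apply] at hcon
  exact h (MvPolynomial.funext fun x => by rw [hcon x, map_zero])

lemma good_pts [Infinite k] (n d c : ℕ) : Good k (n+1) d 0 c ((d+n).choose n - 2 * c) := by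
  obtain ⟨z, hz⟩ := exists_points (Hm k (n+1) d) (X := Fin (n+1) → k) evL (fun f _ h => sep_Hm f h) 0 (c * 2)
  refine ⟨(fun i => i.elim0, fun l j => z (finProdFinEquiv (l, j))), le_trans ?_ (hz.trans ?_)⟩
  · have : FiniteDimensional k (kerOn (Hm k (n+1) d) fun i => evL (z i)) := fin_of_le (kerOn_le _ _)
    refine finrank_mono' fun f hf => ?_
    rw [mem_Id] at hf
    refine mem_kerOn.2 ⟨hf.1, fun i => ?_⟩
    obtain ⟨⟨l, j⟩, rfl⟩ := finProdFinEquiv.surjective i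
    have := hf.2.2.2 l
    rw [evL_apply]
    fin_cases j
    · exact this.left
    · exact this.right
  · rw [finrank_Hm, mul_comm c 2]

lemma choose3 (d : ℕ) : 6 * (d+3).choose 3 = (d+1) * (d+2) * (d+3) := by
  have h2 : ∀ d : ℕ, 2 * (d+2).choose 2 = (d+1) * (d+2) := by
    intro d
    induction d with
    | zero => rfl
    | succ d ih =>
      have := Nat.choose_succ_succ (d+2) 1
      rw [Nat.choose_one_right] at this
      change (d+3).choose 2 = _ + (d+2).choose 2 at this
      change 2 * (d+3).choose 2 = _
      rw [this, mul_add, ih]; ring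
  induction d with
  | zero => rfl
  | succ d ih =>
    have := Nat.choose_succ_succ (d+3) 2
    change (d+4).choose 3 = (d+3).choose 2 + (d+3).choose 3 at this
    change 6 * (d+4).choose 3 = _
    have h := h2 (d+1)
    change 2 * (d+3).choose 2 = _ at h
    rw [this, mul_add, ih]
    linarith

lemma choose4 (d : ℕ) : 24 * (d+4).choose 4 = (d+1) * (d+2) * (d+3) * (d+4) := by
  induction d with
  | zero => rfl
  | succ d ih =>
    have := Nat.choose_succ_succ (d+4) 3
    change (d+5).choose 4 = (d+4).choose 3 + (d+4).choose 4 at this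
    change 24 * (d+5).choose 4 = _
    have h := choose3 (d+1)
    change 6 * (d+4).choose 3 = _ at h
    rw [this, mul_add, ih]
    linarith

lemma choose3_step (d : ℕ) : (d+5).choose 3 = (d+3).choose 3 + (d+3) * (d+3) := by
  have h1 := choose3 d
  have h2 := choose3 (d+2)
  change 6 * (d+5).choose 3 = _ at h2
  linarith

lemma yb (d y : ℕ) (hy : y ≤ 1 + (d+2)*(d+2)/8) : y * (d+1) ≤ (d+3).choose 3 := by
  rcases d with _ | _ | d
  · simp at hy ⊢; omega
  · norm_num [Nat.choose] at hy ⊢; omega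
  · change y ≤ 1 + (d+2+2)*(d+2+2)/8 at hy
    have h1 := choose3 (d+2)
    have h2 : 8 * ((d+2+2)*(d+2+2)/8) ≤ (d+2+2)*(d+2+2) := Nat.mul_div_le _ _
    have h3 : 8 * y ≤ 8 + (d+2+2)*(d+2+2) := by omega
    have h4 : 8 * y * (d+2+1) ≤ (8 + (d+2+2)*(d+2+2)) * (d+2+1) := Nat.mul_le_mul_right _ h3
    nlinarith

lemma quad_num {d y m x : ℕ} (hy : y * (d+1) ≤ (d+3).choose 3) (hx : y + m = x) (hm : m ≤ d+3) (h3 : 2 * y ≤ (d+3) * (d+3-m)) :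
    (d+3).choose 3 - y * (d+1) + ((d+3) * (d+3-m) - 2 * y) = (d+5).choose 3 - x * (d+3) := by
  subst hx
  rw [choose3_step]
  obtain ⟨u, hu⟩ := Nat.exists_eq_add_of_le hm
  have e1 : d + 3 - m = u := by omega
  rw [e1] at h3 ⊢
  have e2 : (d+3)*(d+3) = (d+3) * m + (d+3) * u := by rw [← mul_add, ← hu]
  have e3 : (y+m)*(d+3) = y * (d+1) + 2 * y + (d+3) * m := by ring
  rw [e2, e3]
  omega

lemma lines3 [IsAlgClosed k] [CharZero k] (d y : ℕ) (hy : y ≤ 1 + (d+2)*(d+2)/8) :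
    Good k 4 d 0 y ((d+3).choose 3 - y * (d+1)) := by
  induction d using Nat.strong_induction_on generalizing y with
  | _ d ih =>
  rcases d with _ | _ | d
  · exact (good_pts 3 0 y).mono (by simp; omega)
  · exact (good_pts 3 1 y).mono (by norm_num; omega)
  · change y ≤ 1 + (d+2+2)*(d+2+2)/8 at hy
    let Y := 1 + (d+2)*(d+2)/8
    have h1 := ih d (by omega) (min y Y) (min_le_right _ _)
    have h2 := quad_step (e := 0) (m := y - Y) h1 (Nat.zero_le _) (Nat.zero_le _)
    have e1 : min y Y + (y - Y) - 2 * 0 = y := by omega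
    rw [e1] at h2
    refine h2.mono (le_of_eq ?_)
    have a1 : (d+2+2)*(d+2+2) = (d+2)*(d+2) + 4 * d + 12 := by ring
    have a2 : 2 * (y - Y) ≤ d + 4 := by omega
    refine quad_num (yb d _ (min_le_right _ _)) (by omega) (by omega) ?_
    have a3 : d + 2 ≤ 2 * (d + 3 - (y - Y)) := by omega
    have a4 : (d+3) * (d+2) ≤ (d+3) * (2 * (d + 3 - (y - Y))) := Nat.mul_le_mul_left _ a3
    have a5 : 4 * Y ≤ (d+3) * (d+2) := by
      rcases d with _ | d
      · simp [Y]
      · have : 8 * Y ≤ 8 + (d+1+2)*(d+1+2) := by omega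
        nlinarith
    have a6 : min y Y ≤ Y := min_le_right _ _
    nlinarith

end PartH
end S15


namespace S15
section PartI
variable {k : Type} [Field k]

/-- maximal rank statement for sundials and lines -/
def MR (k : Type) [Field k] (n d : ℕ) : Prop :=
  ∀ s c, s ≤ d - 1 → Good k (n+1) d s c ((d+n).choose n - (2*s+c)*(d+1))

lemma mr_of_ext [CharZero k] {n d t : ℕ} (h2 : 2 * (d-1) ≤ t) (ht : t * (d+1) ≤ (d+n).choose n)
    (hA : Good k (n+1) d (d-1) (t - 2*(d-1)) ((d+n).choose n - t * (d+1)))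
    (hB : Good k (n+1) d (d-1) (t + 1 - 2*(d-1)) 0) : MR k n d := by
  intro s c hs
  obtain ⟨j, hj⟩ := Nat.exists_eq_add_of_le hs
  by_cases hc : c + 2 * s ≤ t
  · rw [hj] at hA
    have h := hA.converts j
    obtain ⟨i, hi⟩ := Nat.exists_eq_add_of_le hc
    have e : t - 2 * (s + j) + 2 * j = c + i := by omega
    rw [e] at h
    refine h.remove_line.mono (le_of_eq ?_)
    have e2 : t * (d+1) = (2 * s + c) * (d+1) + i * (d+1) := by rw [hi]; ring
    omega
  · rw [hj] at hB
    have h := hB.converts j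
    have h' := h.add_line (c + 2 * s - (t + 1))
    have e : t + 1 - 2 * (s + j) + 2 * j + (c + 2 * s - (t + 1)) = c := by omega
    rw [e] at h'
    exact h'.mono (Nat.zero_le _)

lemma core [CharZero k] {n δ z x t' q' N N' N'' : ℕ} (hN : N = N' + N'') (hN' : N' = t' * (δ+2) + q')
    (hz : z ≤ δ + 1) (hqz : q' ≤ z) (hqt : q' ≤ t') (hs : 2 * (δ + 1 - z) ≤ t') (hx : 2 * z ≤ x)
    (hY : Good k (n+1) (δ+1) (δ+1-z) (t' - 2 * (δ+1-z)) q')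
    (hY2 : q' = 0 ∨ Good k (n+1) δ (δ+1-z) (t' - 2 * (δ+1-z)) 0)
    (hZ : Good k n (δ+2) z (x - 2 * z) (N'' - x * (δ+3))) :
    Good k (n+1) (δ+2) (δ+1) (x + t' - 2 * (δ+1)) (N - (x + t') * (δ+3)) := by
  have h := step hZ hY hqz hY2
  have e1 : z + (δ+1-z) = δ + 1 := by omega
  have e2 : x - 2 * z + (t' - 2 * (δ + 1 - z)) = x + t' - 2 * (δ+1) := by omega
  rw [e1, e2] at h
  refine h.mono ?_
  have e3 : (x + t') * (δ+3) = x * (δ+3) + t' * (δ+2) + t' := by ring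
  omega

lemma mr_of_core [CharZero k] {p δ z t t' q' : ℕ} 
    (ht : t = (δ+2+(p+1)).choose (p+1) / (δ+3))
    (ht' : t' = (δ+1+(p+1)).choose (p+1) / (δ+2)) (hq' : q' = (δ+1+(p+1)).choose (p+1) % (δ+2))
    (hz : z ≤ δ + 1) (hqz : q' ≤ z) (hqt : q' ≤ t') (hs : 2 * (δ + 1 - z) ≤ t') (hx : 2 * z + t' ≤ t)
    (hY : Good k (p+1+1) (δ+1) (δ+1-z) (t' - 2 * (δ+1-z)) q')
    (hY2 : q' = 0 ∨ Good k (p+1+1) δ (δ+1-z) (t' - 2 * (δ+1-z)) 0)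
    (hZ : Good k (p+1) (δ+2) z (t - t' - 2 * z) ((δ+2+p).choose p - (t - t') * (δ+3)))
    (hZ2 : t * (δ+3) = (δ+2+(p+1)).choose (p+1) ∨ 
      Good k (p+1) (δ+2) z (t + 1 - t' - 2 * z) ((δ+2+p).choose p - (t + 1 - t') * (δ+3))) : MR k (p+1) (δ+2) := by
  have hN : (δ+2+(p+1)).choose (p+1) = (δ+1+(p+1)).choose (p+1) + (δ+2+p).choose p := by
    have := Nat.choose_succ_succ (δ+2+p) p
    rw [show δ + 1 + (p+1) = δ + 2 + p by ring, add_comm ((δ+2+p).choose (p+1))]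
    exact this
  have hN' : (δ+1+(p+1)).choose (p+1) = t' * (δ+2) + q' := by rw [ht', hq']; exact (Nat.div_add_mod' _ _).symm
  have hA := core (n := p+1) hN hN' hz hqz hqt hs (by omega : 2 * z ≤ t - t') hY hY2 hZ
  have e : t - t' + t' = t := by omega
  rw [e] at hA
  have htN : t * (δ+3) ≤ (δ+2+(p+1)).choose (p+1) := by rw [ht]; exact Nat.div_mul_le_self _ _
  refine mr_of_ext (t := t) (by omega) htN hA ?_
  rcases hZ2 with h0 | hZ2
  · have := hA.add_line 1
    rw [h0, Nat.sub_self] at this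
    have e1 : t - 2 * (δ+1) + 1 = t + 1 - 2 * (δ+1) := by omega
    rw [e1] at this
    exact this
  · have hB := core (n := p+1) hN hN' hz hqz hqt hs (by omega : 2 * z ≤ t + 1 - t') hY hY2 hZ2
    have e1 : t + 1 - t' + t' = t + 1 := by omega
    rw [e1] at hB
    have : (δ+2+(p+1)).choose (p+1) < (t + 1) * (δ+3) := by
      rw [ht]
      exact Nat.lt_mul_of_div_lt (Nat.lt_succ_self _) (by omega)
    refine hB.mono (by omega)

lemma cmono (a : ℕ) {n m : ℕ} (h : n ≤ m) : (a+n).choose n ≤ (a+m).choose m := by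
  rw [← Nat.choose_symm_add, ← Nat.choose_symm_add]
  exact Nat.choose_le_choose _ (by omega)

lemma crel (a n : ℕ) : (a+n).choose n * (a+n+1) = (a+1+n).choose n * (a+1) := by
  have := Nat.choose_mul_succ_eq (a+n) n
  rw [this]
  congr 1
  · congr 1; ring
  · omega

lemma num1 (n δ : ℕ) (hn : 4 ≤ n) : (δ+1+n).choose n % (δ+2) ≤ (δ+1+n).choose n / (δ+2) := by
  have h1 : (δ+1+n).choose n % (δ+2) < δ + 2 := Nat.mod_lt _ (by omega)
  have h2 : δ + 1 ≤ (δ+1+n).choose n / (δ+2) := by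
    rw [Nat.le_div_iff_mul_le (by omega)]
    refine le_trans ?_ (cmono _ hn)
    have h := choose4 (δ+1)
    have : 24 * ((δ+1)*(δ+2)) ≤ (δ+1+1) * (δ+1+2) * (δ+1+3) * (δ+1+4) := by
      have : 24 * (δ+1) ≤ (δ+1+2) * (δ+1+3) * (δ+1+4) := by
        have e : (δ+1+2) * (δ+1+3) * (δ+1+4) = δ*δ*δ + 12*(δ*δ) + 47 * δ + 60 := by ring
        rw [e]
        have := Nat.zero_le (δ*δ*δ)
        have := Nat.zero_le (δ*δ)
        linarith
      nlinarith
    omega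
  omega

lemma num2 (n δ : ℕ) (hn : 4 ≤ n) : (δ+n).choose n ≤ (δ+1+n).choose n / (δ+2) * (δ+1) := by
  have h1 : (δ+1+n).choose n % (δ+2) < δ + 2 := Nat.mod_lt _ (by omega)
  have h2 := Nat.div_add_mod' ((δ+1+n).choose n) (δ+2)
  have h3 := crel δ n
  have h4 := cmono δ hn
  have h5 := choose4 δ
  generalize (δ+1+n).choose n / (δ+2) = t at *
  generalize (δ+1+n).choose n % (δ+2) = q at *
  generalize (δ+1+n).choose n = N' at *
  generalize (δ+n).choose n = N at *
  generalize (δ+4).choose 4 = M at *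
  obtain ⟨m, rfl⟩ := Nat.exists_eq_add_of_le hn
  by_contra hcon
  have hcon : t * (δ+1) + 1 ≤ N := by omega
  have a1 : N * (δ + (4+m) + 1) ≤ (t * (δ+1)) * (δ+2) + (δ+1) * (δ+1) := by
    rw [h3, ← h2]
    nlinarith
  have a2 : N * 3 + (δ+2) ≤ (δ+1)*(δ+1) := by nlinarith
  have a3 : 8 * (δ+1) ≤ (δ+2)*(δ+3)*(δ+4) := by nlinarith
  have a4 : 8 * ((δ+1)*(δ+1)) ≤ 24 * M := by rw [h5]; nlinarith
  omega

lemma choose5 (d : ℕ) : 120 * (d+5).choose 5 = (d+1) * (d+2) * (d+3) * (d+4) * (d+5) := by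
  induction d with
  | zero => rfl
  | succ d ih =>
    have := Nat.choose_succ_succ (d+5) 4
    change (d+6).choose 5 = (d+5).choose 4 + (d+5).choose 5 at this
    change 120 * (d+6).choose 5 = _
    have h := choose4 (d+1)
    change 24 * (d+5).choose 4 = _ at h
    rw [this, mul_add, ih]
    linarith

lemma num3 (n δ : ℕ) (hn : 5 ≤ n) : 2 * (δ+1) + (δ+1+n).choose n / (δ+2) ≤ (δ+2+n).choose n / (δ+3) := by
  have h1 := Nat.div_mul_le_self ((δ+1+n).choose n) (δ+2)
  have h2 : (δ+2+n).choose n < ((δ+2+n).choose n / (δ+3) + 1) * (δ+3) := 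
    Nat.lt_mul_of_div_lt (Nat.lt_succ_self _) (by omega)
  have h3 := crel (δ+1) n
  change _ = (δ+2+n).choose n * (δ+2) at h3
  have h4 := cmono (δ+1) hn
  have h5 := choose5 (δ+1)
  generalize (δ+1+n).choose n / (δ+2) = t' at *
  generalize (δ+2+n).choose n / (δ+3) = t at *
  generalize (δ+1+n).choose n = N' at *
  generalize (δ+2+n).choose n = N at *
  generalize (δ+1+5).choose 5 = M at *
  obtain ⟨m, rfl⟩ := Nat.exists_eq_add_of_le hn
  by_contra hcon
  have hcon : t + 1 ≤ t' + 2 * (δ+1) := by omega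
  have a1 : N + 1 ≤ (t' + 2 * (δ+1)) * (δ+3) := le_trans h2 (Nat.mul_le_mul_right _ hcon)
  have a2 : (N + 1) * (δ+2) ≤ (t' + 2 * (δ+1)) * (δ+3) * (δ+2) := Nat.mul_le_mul_right _ a1
  have a3 : (t' + 2 * (δ+1)) * (δ+3) * (δ+2) ≤ N' * (δ+3) + 2 * (δ+1)*(δ+2)*(δ+3) := by nlinarith
  have a4 : N' * (δ + 1 + (5 + m) + 1) + (δ+2) ≤ N' * (δ+3) + 2 * (δ+1)*(δ+2)*(δ+3) := by nlinarith
  have a5 : N' * 4 < 2 * (δ+1)*(δ+2)*(δ+3) := by nlinarith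
  have a6 : 60 * (δ+1) ≤ (δ+4)*(δ+5)*(δ+6) := by nlinarith
  have a7 : 60 * (δ+1) * ((δ+2)*(δ+3)) ≤ (δ+4)*(δ+5)*(δ+6) * ((δ+2)*(δ+3)) := Nat.mul_le_mul_right _ a6
  nlinarith

lemma mr_succ [CharZero k] {p δ : ℕ} (hp : 4 ≤ p) (h1 : MR k p (δ+2)) (h2 : MR k (p+1) (δ+1)) (h3 : MR k (p+1) δ) :
    MR k (p+1) (δ+2) := by
  have n1 := num1 (p+1) δ (by omega)
  have n2 := num2 (p+1) δ (by omega)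
  have n3 := num3 (p+1) δ (by omega)
  have hm := Nat.mod_lt ((δ+1+(p+1)).choose (p+1)) (by omega : 0 < δ + 2)
  have hdm := Nat.div_add_mod' ((δ+1+(p+1)).choose (p+1)) (δ+2)
  refine mr_of_core (z := δ+1) rfl rfl rfl le_rfl (by omega) n1 (by simp) n3 ?_ (Or.inr ?_) ?_ (Or.inr ?_)
  · have := h2 0 ((δ+1+(p+1)).choose (p+1) / (δ+2)) (by omega)
    simp only [Nat.sub_self, mul_zero, Nat.sub_zero, zero_add] at this ⊢
    refine this.mono ?_
    change _ - _ * (δ + 2) ≤ _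
    omega
  · have := h3 0 ((δ+1+(p+1)).choose (p+1) / (δ+2)) (by omega)
    simp only [Nat.sub_self, mul_zero, Nat.sub_zero, zero_add] at this ⊢
    refine this.mono ?_
    omega
  · refine (h1 (δ+1) _ (by omega)).mono (le_of_eq ?_)
    congr 2
    omega
  · refine (h1 (δ+1) _ (by omega)).mono (le_of_eq ?_)
    congr 2
    omega

/-- numerical conditions for the quadric step -/
def Zc (δ z x : ℕ) : Prop :=
  2 * z ≤ x ∧ z ≤ min (x - z) (1 + (δ+2)*(δ+2)/8) ∧ x - min (x - z) (1 + (δ+2)*(δ+2)/8) ≤ δ + 3 ∧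
    2 * min (x - z) (1 + (δ+2)*(δ+2)/8) ≤ (δ+3) * (δ+3-(x - min (x - z) (1 + (δ+2)*(δ+2)/8)))

instance (δ z x : ℕ) : Decidable (Zc δ z x) := by unfold Zc; infer_instance

lemma good_Z [IsAlgClosed k] [CharZero k] {δ z x : ℕ} (h : Zc δ z x) :
    Good k 4 (δ+2) z (x - 2 * z) ((δ+2+3).choose 3 - x * (δ+3)) := by
  obtain ⟨h1, h2, h3, h4⟩ := h
  generalize hy : min (x - z) (1 + (δ+2)*(δ+2)/8) = y at *
  have hy2 : y ≤ 1 + (δ+2)*(δ+2)/8 := by omega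
  have h := quad_step (e := z) (m := x - y) (lines3 (k := k) δ y hy2) (by omega) h2
  have e : y + (x - y) - 2 * z = x - 2 * z := by omega
  rw [e] at h
  refine h.mono (le_of_eq ?_)
  exact quad_num (yb δ y hy2) (by omega) h3 h4

lemma zc_big {δ z x : ℕ} (hδ : 9 ≤ δ) (h1 : 1 ≤ z) (h2 : 4 * z ≤ 3 * (δ+2))
    (h3 : (δ+4)*(δ+5) ≤ 8 * x + 6) (h4 : 8 * x ≤ (δ+4)*(δ+5) + 14) : Zc δ z x := by
  unfold Zc
  obtain ⟨d, hd⟩ : ∃ d, d = δ + 2 := ⟨_, rfl⟩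
  have e0 : δ = d - 2 := by omega
  have e1 : (δ+4)*(δ+5) = d*d + 5*d + 6 := by rw [hd]; ring
  have e2 : δ + 3 = d + 1 := by omega
  rw [e1] at h3 h4
  rw [e2, ← hd]
  have hS : 11 * d ≤ d * d := by nlinarith
  obtain ⟨Y, hY⟩ : ∃ Y, Y = 1 + d*d/8 := ⟨_, rfl⟩
  have hY1 : d*d+1 ≤ 8 * Y := by omega
  have hY2 : 8 * Y ≤ d*d + 8 := by omega
  rw [← hY]
  clear hY
  rw [← hd] at h2
  refine ⟨by omega, by omega, by omega, ?_⟩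
  by_cases hc : x - z ≤ Y
  · rw [min_eq_left hc]
    have e : x - (x - z) = z := by omega
    rw [e]
    obtain ⟨m, hm⟩ := Nat.exists_eq_add_of_le (by omega : z ≤ d + 1)
    obtain ⟨w, hw⟩ := Nat.exists_eq_add_of_le (by omega : z ≤ x)
    have e4 : d + 1 - z = m := by omega
    have e5 : x - z = w := by omega
    rw [e4, e5]
    have hm' : (m:ℤ) = d + 1 - z := by omega
    have hw' : (w:ℤ) = x - z := by omega
    zify at *
    rw [hm', hw']
    nlinarith [mul_nonneg (by linarith : (0:ℤ) ≤ 3 * d - 4 * z) (by linarith : (0:ℤ) ≤ (d:ℤ) - 1)]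
  · rw [min_eq_right (by omega)]
    obtain ⟨m, hm⟩ := Nat.exists_eq_add_of_le (by omega : x - Y ≤ d + 1)
    have e4 : d + 1 - (x - Y) = m := by omega
    rw [e4]
    have hm' : 3 * d ≤ 8 * m + 11 := by omega
    zify at *
    nlinarith [mul_nonneg (by linarith : (0:ℤ) ≤ 8 * m + 11 - 3 * d) (by linarith : (0:ℤ) ≤ (d:ℤ) + 1)]

lemma c43 (d : ℕ) : 4 * (d+4).choose 4 = (d+1) * (d+4).choose 3 := by
  have h1 := choose4 d
  have h2 := choose3 (d+1)
  change 6 * (d+4).choose 3 = _ at h2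
  have : 6 * (4 * (d+4).choose 4) = 6 * ((d+1) * (d+4).choose 3) := by
    calc _ = 24 * (d+4).choose 4 := by ring
      _ = (d+1) * (6 * (d+4).choose 3) := by rw [h1, h2]; ring
      _ = _ := by ring
  omega

lemma div4 {N d B : ℕ} (h : 4 * N = (d+1) * B) :
    4 * (N / (d+1)) ≤ B ∧ B ≤ 4 * (N/(d+1)) + 3 ∧ 4 * (N % (d+1)) = (d+1) * (B - 4 * (N/(d+1))) := by
  have h1 := Nat.div_add_mod' N (d+1)
  have h2 := Nat.mod_lt N (by omega : 0 < d + 1)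
  generalize N / (d+1) = t at *
  generalize N % (d+1) = q at *
  have a : 4 * t ≤ B := by
    by_contra hc
    have hc : B + 1 ≤ 4 * t := by omega
    nlinarith
  refine ⟨a, ?_, ?_⟩
  · by_contra hc
    have hc : 4 * t + 4 ≤ B := by omega
    nlinarith
  · obtain ⟨f, rfl⟩ := Nat.exists_eq_add_of_le a
    rw [Nat.add_sub_cancel_left]
    nlinarith

lemma num4 (δ : ℕ) : ∃ z, z ≤ δ + 1 ∧ (δ+5).choose 4 % (δ+2) ≤ z ∧ 1 ≤ z ∧
    ((δ+5).choose 4 % (δ+2) = 0 ∨ δ + 1 - z ≤ δ - 1) ∧ 2 * (δ+1-z) ≤ (δ+5).choose 4 / (δ+2) ∧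
    (δ+5).choose 4 / (δ+2) ≤ (δ+6).choose 4 / (δ+3) ∧
    Zc δ z ((δ+6).choose 4 / (δ+3) - (δ+5).choose 4 / (δ+2)) ∧
    ((δ+6).choose 4 / (δ+3) * (δ+3) = (δ+6).choose 4 ∨ Zc δ z ((δ+6).choose 4 / (δ+3) + 1 - (δ+5).choose 4 / (δ+2))) := by
  refine ⟨max ((δ+5).choose 4 % (δ+2)) 1, ?_⟩
  by_cases hδ : δ < 9
  · interval_cases δ <;> decide
  · obtain ⟨a1, a2, a3⟩ := div4 (c43 (δ+1))
    obtain ⟨b1, b2, -⟩ := div4 (c43 (δ+2))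
    have c1 := choose3 (δ+2)
    have c2 := choose3 (δ+3)
    change 4 * ((δ+5).choose 4 / (δ+2)) ≤ (δ+5).choose 3 at a1
    change (δ+5).choose 3 ≤ 4 * ((δ+5).choose 4 / (δ+2)) + 3 at a2
    change 4 * ((δ+5).choose 4 % (δ+2)) = (δ+2) * ((δ+5).choose 3 - 4 * ((δ+5).choose 4 / (δ+2))) at a3
    change 4 * ((δ+6).choose 4 / (δ+3)) ≤ (δ+6).choose 3 at b1
    change (δ+6).choose 3 ≤ 4 * ((δ+6).choose 4 / (δ+3)) + 3 at b2
    change 6 * (δ+5).choose 3 = (δ+3) * (δ+4) * (δ+5) at c1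
    change 6 * (δ+6).choose 3 = (δ+4) * (δ+5) * (δ+6) at c2
    have hBA : 2 * (δ+6).choose 3 = 2 * (δ+5).choose 3 + (δ+4)*(δ+5) := by nlinarith
    have hA : 8 * δ + 8 ≤ (δ+5).choose 3 := by
      obtain ⟨e, rfl⟩ := Nat.exists_eq_add_of_le (not_lt.1 hδ)
      nlinarith [Nat.zero_le (e*e*e), Nat.zero_le (e*e)]
    clear c1 c2
    generalize (δ+5).choose 4 / (δ+2) = t' at *
    generalize (δ+6).choose 4 / (δ+3) = t at *
    generalize (δ+5).choose 4 % (δ+2) = q at *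
    generalize (δ+5).choose 3 = A at *
    generalize (δ+6).choose 3 = B at *
    generalize (δ+6).choose 4 = N at *
    have hq : q = 0 ∨ (2 ≤ q ∧ 4 * q ≤ 3 * (δ+2)) := by
      have : A - 4 * t' = 0 ∨ A - 4 * t' = 1 ∨ A - 4 * t' = 2 ∨ A - 4 * t' = 3 := by omega
      rcases this with h | h | h | h <;> rw [h] at a3 <;> omega
    have hS : 13 * 14 ≤ (δ+4)*(δ+5) := Nat.mul_le_mul (by omega) (by omega)
    refine ⟨by omega, by omega, by omega, by omega, by omega, by omega, ?_, Or.inr ?_⟩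
    · refine zc_big (by omega) (by omega) (by omega) ?_ ?_ <;> omega
    · refine zc_big (by omega) (by omega) (by omega) ?_ ?_ <;> omega

lemma mr_four_succ [IsAlgClosed k] [CharZero k] {δ : ℕ} (h2 : MR k 4 (δ+1)) (h3 : MR k 4 δ) :
    MR k 4 (δ+2) := by
  obtain ⟨z, z1, z2, z3, z4, z5, z6, z7, z8⟩ := num4 δ
  have n1 := num1 4 δ le_rfl
  have n2 := num2 4 δ le_rfl
  have hdm := Nat.div_add_mod' ((δ+5).choose 4) (δ+2)
  change (δ+5).choose 4 % (δ+2) ≤ (δ+5).choose 4 / (δ+2) at n1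
  change _ ≤ (δ+5).choose 4 / (δ+2) * (δ+1) at n2
  have e1 : 2 * (δ+1-z) + ((δ+5).choose 4 / (δ+2) - 2 * (δ+1-z)) = (δ+5).choose 4 / (δ+2) := by omega
  refine mr_of_core (p := 3) (z := z) rfl rfl rfl z1 z2 n1 z5 ?_ ?_ ?_ (good_Z z7) (z8.imp id good_Z)
  · have := z7.1
    change 2 * z + (δ+5).choose 4 / (δ+2) ≤ (δ+6).choose 4 / (δ+3)
    omega
  · refine (h2 (δ+1-z) _ (by omega)).mono ?_
    change (δ+5).choose 4 - (2 * (δ+1-z) + ((δ+5).choose 4 / (δ+2) - 2 * (δ+1-z))) * (δ+2) ≤ (δ+5).choose 4 % (δ+2)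
    rw [e1]
    omega
  · rcases z4 with h | h
    · exact Or.inl h
    · refine Or.inr ((h3 (δ+1-z) _ h).mono ?_)
      change (δ+4).choose 4 - (2 * (δ+1-z) + ((δ+5).choose 4 / (δ+2) - 2 * (δ+1-z))) * (δ+1) ≤ 0
      rw [e1]
      omega

lemma mr_small [CharZero k] (n d : ℕ) (hd : d ≤ 1) : MR k n d := by
  intro s c hs
  have : s = 0 := by omega
  subst this
  refine (good_pts n d c).mono ?_
  have h : (2 * 0 + c) * (d+1) ≤ 2 * c := by
    have : c * (d+1) ≤ c * 2 := Nat.mul_le_mul_left _ (by omega)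
    rw [Nat.mul_zero, zero_add]
    omega
  exact Nat.sub_le_sub_left h _

theorem mr_all [IsAlgClosed k] [CharZero k] (m d : ℕ) : MR k (m+4) d := by
  induction m generalizing d with
  | zero =>
    induction d using Nat.strong_induction_on with
    | _ d ih =>
      rcases d with _ | _ | δ
      · exact mr_small _ _ (by omega)
      · exact mr_small _ _ (by omega)
      · exact mr_four_succ (ih _ (by omega)) (ih _ (by omega))
  | succ m ihm =>
    induction d using Nat.strong_induction_on with
    | _ d ih =>
      rcases d with _ | _ | δ
      · exact mr_small _ _ (by omega)
      · exact mr_small _ _ (by omega)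
      · exact mr_succ (by omega) (ihm _) (ih _ (by omega)) (ih _ (by omega))

end PartI
end S15


namespace S15
section PartJ
variable {k : Type} [Field k]

lemma mem_van_iff {N : ℕ} {V : Set (Fin N → k)} {f : MvPolynomial (Fin N) k} :
    f ∈ vanIdeal k N V ↔ ∀ v ∈ V, eval v f = 0 := Iff.rfl

lemma mem_van_pair {N : ℕ} {a b : Fin N → k} {f : MvPolynomial (Fin N) k} :
    f ∈ vanIdeal k N (Submodule.span k {a, b} : Submodule k (Fin N → k)) ↔ vanL f a b := by
  rw [mem_van_iff]
  constructor
  · intro h s t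
    exact h _ (Submodule.mem_span_pair.2 ⟨s, t, rfl⟩)
  · intro h v hv
    obtain ⟨s, t, rfl⟩ := Submodule.mem_span_pair.1 hv
    exact h s t

lemma mem_van_single {N d : ℕ} {a : Fin N → k} {f : MvPolynomial (Fin N) k} (hf : f ∈ Hm k N d) :
    f ∈ vanIdeal k N (Submodule.span k {a} : Submodule k (Fin N → k)) ↔ eval a f = 0 := by
  rw [mem_van_iff]
  constructor
  · intro h
    exact h _ (Submodule.mem_span_singleton_self a)
  · intro h v hv
    obtain ⟨s, rfl⟩ := Submodule.mem_span_singleton.1 hv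
    rw [eval_smul hf, h, mul_zero]

lemma eval_aeval {N : ℕ} (p : Fin N → k) (A : Fin N → MvPolynomial (Fin N) k)
    (q : MvPolynomial (Fin N) k) : eval p (aeval A q) = eval (fun m => eval p (A m)) q := by
  induction q using MvPolynomial.induction_on with
  | C c => simp
  | add f g hf hg => rw [map_add, map_add, hf, hg, map_add]
  | mul_X f i hf => rw [map_mul, map_mul, hf, map_mul, aeval_X, eval_X]

lemma exists_dual {N m : ℕ} {x : Fin m → Fin N → k} (hx : LinearIndependent k x) :
    ∃ l : Fin m → ((Fin N → k) →ₗ[k] k), ∀ i j, l i (x j) = if j = i then 1 else 0 := by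
  obtain ⟨g, hg⟩ := LinearMap.exists_leftInverse_of_injective (Fintype.linearCombination k x)
    (LinearMap.ker_eq_bot.2 hx.fintypeLinearCombination_injective)
  refine ⟨fun i => (LinearMap.proj i).comp g, fun i j => ?_⟩
  have : g (x j) = Pi.single j 1 := by
    have := LinearMap.congr_fun hg (Pi.single j 1)
    simpa using this
  simp [this, Pi.single_apply, eq_comm]

/-- the linear form attached to a functional -/
noncomputable def lf {N : ℕ} (l : (Fin N → k) →ₗ[k] k) : MvPolynomial (Fin N) k :=
  ∑ m, C (l (Pi.single m 1)) * X m

lemma eval_lf {N : ℕ} (l : (Fin N → k) →ₗ[k] k) (p : Fin N → k) : eval p (lf l) = l p := by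
  have : p = ∑ m, p m • Pi.single m (1:k) := by
    ext i; simp [Finset.sum_apply, Pi.single_apply]
  conv_rhs => rw [this]
  simp [lf, mul_comm]

/-- first order Taylor expansion modulo the square of an ideal -/
lemma taylor {N : ℕ} {R : Type*} [CommRing R] [Algebra k R] (J : Ideal R) (a b : Fin N → R)
    (hb : ∀ m, b m ∈ J) (f : MvPolynomial (Fin N) k) :
    aeval (fun m => a m + b m) f - (aeval a f + ∑ m, b m * aeval a (pderiv m f)) ∈ J ^ 2 := by
  have hS : ∀ g : MvPolynomial (Fin N) k, ∑ m, b m * aeval a (pderiv m g) ∈ J := fun g =>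
    Ideal.sum_mem _ fun m _ => Ideal.mul_mem_right _ _ (hb m)
  induction f using MvPolynomial.induction_on with
  | C c => simp
  | add f g hf hg =>
    have := add_mem hf hg
    simp only [map_add, mul_add, Finset.sum_add_distrib]
    convert this using 1
    ring
  | mul_X f i hf =>
    have e : ∑ m, b m * aeval a (pderiv m (f * X i)) =
        (∑ m, b m * aeval a (pderiv m f)) * a i + aeval a f * b i := by
      simp only [Derivation.leibniz, smul_eq_mul, map_add, map_mul, aeval_X, mul_add,
        Finset.sum_add_distrib, pderiv_X]
      rw [add_comm, Finset.sum_mul]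
      congr 1
      · exact Finset.sum_congr rfl fun m _ => by ring
      · rw [Finset.sum_eq_single i]
        · simp; ring
        · intro m _ hm
          simp [Pi.single_apply, hm.symm]
        · simp
    have h2 : (∑ m, b m * aeval a (pderiv m f)) * b i ∈ J ^ 2 := by
      rw [pow_two]; exact Ideal.mul_mem_mul (hS f) (hb i)
    have := add_mem (Ideal.mul_mem_right (a i + b i) _ hf) h2
    rw [e]
    simp only [map_mul, aeval_X]
    convert this using 1
    ring

lemma ddL_smul {N d : ℕ} {f : MvPolynomial (Fin N) k} (hf : f ∈ Hm k N d) (s : k) (p w : Fin N → k) :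
    ddL (s • p) w f = s ^ (d-1) * ddL p w f := by
  rw [ddL_apply, ddL_apply, Finset.mul_sum]
  refine Finset.sum_congr rfl fun i _ => ?_
  have : pderiv i f ∈ Hm k N (d-1) := IsHomogeneous.pderiv hf
  rw [eval_smul this]
  ring

lemma dd_of_van [Infinite k] {N : ℕ} {f : MvPolynomial (Fin N) k} {p w : Fin N → k}
    (h : ∀ e : k, eval (p + e • w) f = 0) : ddL p w f = 0 := by
  have : lp p w f = 0 := Polynomial.funext fun e => by rw [lp_eval, h, Polynomial.eval_zero]
  rw [← lp_coeff_one, this, Polynomial.coeff_zero]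

lemma dd_of_vanL [Infinite k] {N : ℕ} {f : MvPolynomial (Fin N) k} {p w : Fin N → k}
    (h : vanL f p w) : ddL p w f = 0 :=
  dd_of_van fun e => by simpa using h 1 e

lemma dd_comb {N : ℕ} {ι : Type*} (s : Finset ι) (p : Fin N → k) (c : ι → k) (w : ι → Fin N → k)
    (f : MvPolynomial (Fin N) k) : ddL p (∑ i ∈ s, c i • w i) f = ∑ i ∈ s, c i * ddL p (w i) f := by
  simp only [ddL_apply, Finset.sum_apply, Pi.smul_apply, smul_eq_mul, Finset.sum_mul, Finset.mul_sum]
  rw [Finset.sum_comm]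
  exact Finset.sum_congr rfl fun _ _ => Finset.sum_congr rfl fun _ _ => by ring

lemma inf_span {N : ℕ} {x : Fin 4 → Fin N → k} (hx : LinearIndependent k x) :
    (Submodule.span k {x 0, x 1} ⊓ Submodule.span k {x 0, x 2} : Submodule k (Fin N → k)) = 
      Submodule.span k {x 0} := by
  obtain ⟨l, hl⟩ := exists_dual hx
  apply le_antisymm
  · rintro p ⟨h1, h2⟩
    obtain ⟨s, t, rfl⟩ := Submodule.mem_span_pair.1 h1
    obtain ⟨s', t', h⟩ := Submodule.mem_span_pair.1 h2
    have := congrArg (l 1) h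
    simp [hl] at this
    subst this
    exact Submodule.mem_span_singleton.2 ⟨s, by simp⟩
  · refine le_inf ?_ ?_ <;> exact Submodule.span_mono (by simp)

lemma mem_sundial [Infinite k] {N d : ℕ} {x : Fin 4 → Fin N → k} (hx : LinearIndependent k x)
    {f : MvPolynomial (Fin N) k} (hf : f ∈ Hm k N d) :
    f ∈ sundialIdeal k N (Submodule.span k {x 0, x 1}) (Submodule.span k {x 0, x 2})
      (Submodule.span k (Set.range x)) ↔
      (vanL f (x 0) (x 1) ∧ vanL f (x 0) (x 2)) ∧ ddL (x 0) (x 3) f = 0 := by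
  unfold sundialIdeal
  rw [inf_span hx]
  rw [Ideal.mem_inf, Ideal.mem_inf, mem_van_pair, mem_van_pair]
  refine and_congr_right fun hv => ?_
  constructor
  · intro h
    rw [Ideal.add_eq_sup] at h
    obtain ⟨g, hg, u, hu, rfl⟩ := Submodule.mem_sup.1 h
    have h1 : ddL (x 0) (x 3) u = 0 := dd_of_van fun e => by
      refine hu _ (Submodule.add_mem _ ?_ (Submodule.smul_mem _ _ ?_)) <;>
        exact Submodule.subset_span ⟨_, rfl⟩
    rw [map_add, h1, add_zero]
    rw [pow_two] at hg
    refine Submodule.mul_induction_on hg ?_ ?_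
    · intro a ha b hb
      have ha' := ha _ (Submodule.mem_span_singleton_self (x 0))
      have hb' := hb _ (Submodule.mem_span_singleton_self (x 0))
      rw [ddL_mul, ha', hb']
      ring
    · intro a b ha hb
      rw [map_add, ha, hb, add_zero]
  · intro h3
    obtain ⟨l, hl⟩ := exists_dual hx
    let A : Fin N → MvPolynomial (Fin N) k := fun m => C (x 0 m) * lf (l 0)
    let B : Fin N → MvPolynomial (Fin N) k := fun m => ∑ i : Fin 3, C (x i.succ m) * lf (l i.succ)
    let g := aeval (fun m => A m + B m) f
    have hAe : ∀ p (q : MvPolynomial (Fin N) k), eval p (aeval A q) = eval (l 0 p • x 0) q := by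
      intro p q
      rw [eval_aeval]
      congr 2
      ext m
      simp [A, eval_lf, mul_comm]
    have hge : ∀ p, eval p g = eval (∑ i, l i p • x i) f := by
      intro p
      rw [eval_aeval]
      congr 2
      ext m
      rw [Fin.sum_univ_succ]
      simp [A, B, eval_lf, mul_comm]
    have hB : ∀ m, B m ∈ vanIdeal k N (Submodule.span k {x 0} : Submodule k (Fin N → k)) := by
      intro m v hv
      obtain ⟨s, rfl⟩ := Submodule.mem_span_singleton.1 hv
      simp [B, eval_lf, hl, Fin.succ_ne_zero, (Fin.succ_ne_zero _).symm]
    have h0 : aeval A f + ∑ m, B m * aeval A (pderiv m f) = 0 := by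
      refine MvPolynomial.funext fun p => ?_
      have e : eval p (∑ m, B m * aeval A (pderiv m f)) = 
          ddL (l 0 p • x 0) (∑ i : Fin 3, l i.succ p • x i.succ) f := by
        rw [ddL_apply, map_sum]
        refine Finset.sum_congr rfl fun m _ => ?_
        rw [map_mul, hAe]
        congr 1
        simp [B, eval_lf, mul_comm]
      rw [map_add, e, hAe, eval_smul hf, hv.1.left, dd_comb, map_zero, Fin.sum_univ_three,
        ddL_smul hf, ddL_smul hf, ddL_smul hf]
      have e1 := dd_of_vanL hv.1
      have e2 := dd_of_vanL hv.2
      change _ + (_ * (_ * ddL (x 0) (x 1) f) + _ * (_ * ddL (x 0) (x 2) f) + _ * (_ * ddL (x 0) (x 3) f)) = 0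
      rw [e1, e2, h3]
      ring
    have h1 := taylor _ A B hB f
    rw [h0, sub_zero] at h1
    rw [Ideal.add_eq_sup]
    refine Submodule.mem_sup.2 ⟨g, h1, f - g, ?_, by ring⟩
    intro p hp
    rw [map_sub, hge, sub_eq_zero]
    congr 1
    obtain ⟨c, rfl⟩ := (Submodule.mem_span_range_iff_exists_fun k).1 hp
    refine congrArg _ (Finset.sum_congr rfl fun i _ => ?_)
    simp [hl]

end PartJ
end S15


namespace S15
section PartK
variable {k : Type} [Field k]

lemma indep_pair {N : ℕ} {x : Fin 4 → Fin N → k} (hx : LinearIndependent k x) {i j : Fin 4} (h : i ≠ j) :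
    Module.finrank k (Submodule.span k {x i, x j}) = 2 := by
  have : LinearIndependent k ![x i, x j] := by
    have := hx.comp ![i, j] (by
      intro a b hab
      fin_cases a <;> fin_cases b <;> simp_all)
    convert this using 1
    ext a; fin_cases a <;> rfl
  have h2 := finrank_span_eq_card this
  have e : Set.range ![x i, x j] = {x i, x j} := by
    ext z
    simp [or_comm]
  rw [e, Fintype.card_fin] at h2
  exact h2

lemma hdim_eq {N d : ℕ} {I : Ideal (MvPolynomial (Fin N) k)} {K : Submodule k (MvPolynomial (Fin N) k)}
    (hK : K ≤ Hm k N d) (h : ∀ f ∈ Hm k N d, f ∈ I ↔ f ∈ K) : hdim k N I d = Module.finrank k K := by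
  have e : Submodule.restrictScalars k
        (I : Submodule (MvPolynomial (Fin N) k) (MvPolynomial (Fin N) k))
      ⊓ MvPolynomial.homogeneousSubmodule (Fin N) k d = K := by
    ext f
    constructor
    · rintro ⟨h1, h2⟩
      exact (h f h2).1 h1
    · intro hf
      exact ⟨(h f (hK hf)).2 hf, hK hf⟩
  unfold hdim
  rw [e]

lemma sundial_is {N : ℕ} {x : Fin 4 → Fin N → k} (hx : LinearIndependent k x) :
    IsSundial k N (Submodule.span k {x 0, x 1}) (Submodule.span k {x 0, x 2})
      (Submodule.span k (Set.range x)) := by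
  have h1 : Module.finrank k (Submodule.span k {x 0}) = 1 := finrank_span_singleton (hx.ne_zero 0)
  have h2 := indep_pair hx (i := 0) (j := 1) (by decide)
  refine ⟨h2, indep_pair hx (by decide), ?_, ?_, ?_, ?_⟩
  · intro h
    have := inf_span hx
    rw [← h, inf_idem] at this
    rw [this, h1] at h2
    omega
  · rw [inf_span hx, h1]
  · refine sup_le (Submodule.span_mono ?_) (Submodule.span_mono ?_) <;>
    · intro y hy
      rcases hy with rfl | rfl <;> exact ⟨_, rfl⟩
  · rw [finrank_span_eq_card hx, Fintype.card_fin]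

/-- minors of the vectors in a configuration -/
noncomputable def mino {m n : ℕ} (hm : m ≤ n) (x : Fin m → Fin n → k) : k :=
  (Matrix.of fun i j => x i (Fin.castLE hm j)).det

lemma indep_of_mino {m n : ℕ} (hm : m ≤ n) {x : Fin m → Fin n → k} (h : mino hm x ≠ 0) :
    LinearIndependent k x := by
  have := Matrix.linearIndependent_rows_of_det_ne_zero h
  exact LinearIndependent.of_comp (LinearMap.funLeft k k (Fin.castLE hm)) this

lemma mino_std {m n : ℕ} (hm : m ≤ n) :
    mino hm (fun i => (Pi.single (Fin.castLE hm i) 1 : Fin n → k)) ≠ 0 := by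
  have : (Matrix.of fun i j => (Pi.single (Fin.castLE hm i) 1 : Fin n → k) (Fin.castLE hm j)) =
      (1 : Matrix (Fin m) (Fin m) k) := by
    ext i j
    simp [Matrix.one_apply, Pi.single_apply, eq_comm]
  rw [mino, this, Matrix.det_one]
  exact one_ne_zero

lemma exists_nondeg [Infinite k] {n d s c r : ℕ} (hn : 4 ≤ n) (h : Good k n d s c r) :
    ∃ C : Cfg k n (Fin s) (Fin c), Module.finrank k (Id (Hm k n d) Set.univ C) ≤ r ∧
      (∀ i, LinearIndependent k (C.1 i)) ∧ ∀ l, LinearIndependent k (C.2 l) := by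
  have h2 : 2 ≤ n := by omega
  have o1 := lineOpen_Id (k := k) (ι := Fin s) (κ := Fin c) (Hm k n d) Set.univ r
  have o2 : LineOpen (k := k) {C : Cfg k n (Fin s) (Fin c) | ∀ i, mino hn (C.1 i) ≠ 0} :=
    lineOpen_forall_ne _ fun i p v => PolyFn.det fun a b => by
      simpa using PolyFn.affine (p.1 i a (Fin.castLE hn b)) (v.1 i a (Fin.castLE hn b))
  have o3 : LineOpen (k := k) {C : Cfg k n (Fin s) (Fin c) | ∀ i, mino h2 (C.2 i) ≠ 0} :=
    lineOpen_forall_ne _ fun i p v => PolyFn.det fun a b => by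
      simpa using PolyFn.affine (p.2 i a (Fin.castLE h2 b)) (v.2 i a (Fin.castLE h2 b))
  obtain ⟨C, h1, h2, h3⟩ := o1.inter_nonempty (o2.inter o3) h
    ⟨(fun _ i => Pi.single (Fin.castLE hn i) 1, fun _ i => Pi.single (Fin.castLE h2 i) 1),
      fun _ => mino_std hn, fun _ => mino_std h2⟩
  exact ⟨C, h1, fun i => indep_of_mino hn (h2 i), fun i => indep_of_mino _ (h3 i)⟩

lemma sep_ne [Infinite k] {N d : ℕ} (hd : 1 ≤ d) {f : MvPolynomial (Fin N) k} (hf : f ∈ Hm k N d) (h : f ≠ 0) :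
    ∃ x : {v : Fin N → k // v ≠ 0}, evL x.1 f ≠ 0 := by
  obtain ⟨x, hx⟩ := sep_Hm f h
  refine ⟨⟨x, ?_⟩, hx⟩
  rintro rfl
  apply hx
  have := eval_smul hf 0 0
  rw [zero_smul] at this
  rw [evL_apply, this, zero_pow (by omega), zero_mul]

/-- the points drop the dimension back -/
lemma exists_drop [Infinite k] {n d a b c r : ℕ} (hd : 1 ≤ d) (C : Cfg k (n+1) (Fin (a+b)) (Fin c))
    (h : Module.finrank k (Id (Hm k (n+1) d) Set.univ C) ≤ r) :
    ∃ y : Fin b → {v : Fin (n+1) → k // v ≠ 0},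
      Module.finrank k (kerOn (Id (Hm k (n+1) d) (Set.range (Fin.castAdd b)) C) (fun j => evL (y j).1)) ≤ r := by
  have := finId (d := d) (Set.range (Fin.castAdd b)) C
  have := finId (d := d) Set.univ C
  obtain ⟨y, hy⟩ := exists_points (Id (Hm k (n+1) d) (Set.range (Fin.castAdd b)) C)
    (X := {v : Fin (n+1) → k // v ≠ 0}) (fun v => evL v.1) 
    (fun f hf h0 => sep_ne hd (Id_le _ _ _ hf) h0) ⟨Pi.single 0 1, by simp⟩ b
  refine ⟨y, hy.trans ?_⟩
  have h1 := finrank_le_kerOn_add (Id (Hm k (n+1) d) (Set.range (Fin.castAdd b)) C)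
    (fun j : Fin b => ddL (C.1 (Fin.natAdd a j) 0) (C.1 (Fin.natAdd a j) 3))
  have h2 : kerOn (Id (Hm k (n+1) d) (Set.range (Fin.castAdd b)) C)
    (fun j : Fin b => ddL (C.1 (Fin.natAdd a j) 0) (C.1 (Fin.natAdd a j) 3)) ≤ Id (Hm k (n+1) d) Set.univ C := by
    intro f hf
    rw [mem_kerOn, mem_Id] at hf
    obtain ⟨⟨hf0, hf1, hf2, hf3⟩, hf4⟩ := hf
    refine mem_Id.2 ⟨hf0, hf1, fun i _ => ?_, hf3⟩
    refine Fin.addCases (fun i => ?_) (fun i => ?_) i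
    · exact hf2 _ ⟨i, rfl⟩
    · exact hf4 i
  have h3 := finrank_mono' h2
  rw [Fintype.card_fin] at h1
  omega

lemma lower [CharZero k] {n d a b c : ℕ} (C : Cfg k (n+1) (Fin (a+b)) (Fin c))
    (y : Fin b → Fin (n+1) → k) :
    (d+n).choose n ≤ Module.finrank k (kerOn (Id (Hm k (n+1) d) (Set.range (Fin.castAdd b)) C) (fun j => evL (y j)))
      + (2*a+2*b+c)*(d+1) := by
  let φ : (Fin (a+b) × Fin (d+1)) ⊕ (Fin (a+b) × Fin d) ⊕ Fin a ⊕ Fin b ⊕ (Fin c × Fin (d+1)) →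
      MvPolynomial (Fin (n+1)) k →ₗ[k] k
    | Sum.inl (i, e) => evL (C.1 i 0 + ((e : ℕ) : k) • C.1 i 1)
    | Sum.inr (Sum.inl (i, e)) => evL (C.1 i 0 + ((e.succ : ℕ) : k) • C.1 i 2)
    | Sum.inr (Sum.inr (Sum.inl i)) => ddL (C.1 (Fin.castAdd b i) 0) (C.1 (Fin.castAdd b i) 3)
    | Sum.inr (Sum.inr (Sum.inr (Sum.inl j))) => evL (y j)
    | Sum.inr (Sum.inr (Sum.inr (Sum.inr (l, e)))) => evL (C.2 l 0 + ((e : ℕ) : k) • C.2 l 1)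
  have h := finrank_le_kerOn_add (Hm k (n+1) d) φ
  rw [finrank_Hm] at h
  have hle : kerOn (Hm k (n+1) d) φ ≤ 
      kerOn (Id (Hm k (n+1) d) (Set.range (Fin.castAdd b)) C) (fun j => evL (y j)) := by
    intro f hf
    rw [mem_kerOn] at hf
    obtain ⟨hf, hφ⟩ := hf
    have p1 : ∀ i, vanL f (C.1 i 0) (C.1 i 1) := fun i => vanL_of_points hf _ _ fun e => by
      simpa [φ] using hφ (Sum.inl (i, e))
    refine mem_kerOn.2 ⟨mem_Id.2 ⟨hf, fun i => ⟨p1 i, vanL_of_points hf _ _ fun e => ?_⟩, ?_, fun l => 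
      vanL_of_points hf _ _ fun e => ?_⟩, fun j => hφ (Sum.inr (Sum.inr (Sum.inr (Sum.inl j))))⟩
    · refine Fin.cases ?_ (fun e => ?_) e
      · simpa using (p1 i).left
      · simpa only [φ, evL_apply] using hφ (Sum.inr (Sum.inl (i, e)))
    · rintro _ ⟨i, rfl⟩
      exact hφ (Sum.inr (Sum.inr (Sum.inl i)))
    · simpa [φ] using hφ (Sum.inr (Sum.inr (Sum.inr (Sum.inr (l, e)))))
  have : FiniteDimensional k (kerOn (Id (Hm k (n+1) d) (Set.range (Fin.castAdd b)) C) (fun j => evL (y j))) :=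
    fin_of_le ((kerOn_le _ _).trans (Id_le _ _ _))
  have h2 := finrank_mono' hle
  refine h.trans (add_le_add h2 (le_of_eq ?_))
  simp only [Fintype.card_sum, Fintype.card_prod, Fintype.card_fin]
  ring

theorem main_exists [IsAlgClosed k] [CharZero k] (n d a b c : ℕ) (hn : 4 ≤ n) (hd : 1 ≤ d) (hab : a + b ≤ d - 1) :
      ∃ (V₁ V₂ T : Fin a → Submodule k (Fin (n+1) → k))
        (D₁ D₂ : Fin b → Submodule k (Fin (n+1) → k))
        (R : Fin b → Submodule k (Fin (n+1) → k))
        (M : Fin c → Submodule k (Fin (n+1) → k)),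
        (∀ i, IsSundial k (n+1) (V₁ i) (V₂ i) (T i)) ∧
        (∀ j, Module.finrank k (D₁ j) = 2 ∧ Module.finrank k (D₂ j) = 2 ∧
          D₁ j ≠ D₂ j ∧ Module.finrank k ↥(D₁ j ⊓ D₂ j) = 1) ∧
        (∀ j, Module.finrank k (R j) = 1) ∧
        (∀ l, Module.finrank k (M l) = 2) ∧
        hdim k (n+1) ((⨅ i, sundialIdeal k (n+1) (V₁ i) (V₂ i) (T i)) ⊓
            (⨅ j, vanIdeal k (n+1) ↑(D₁ j) ⊓ vanIdeal k (n+1) ↑(D₂ j)) ⊓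
            (⨅ j, vanIdeal k (n+1) ↑(R j)) ⊓
            ⨅ l, vanIdeal k (n+1) ↑(M l)) d
          = (d+n).choose n - (2*a + 2*b + c) * (d+1) := by
  obtain ⟨m, rfl⟩ := Nat.exists_eq_add_of_le' hn
  obtain ⟨C, hC, i1, i2⟩ := exists_nondeg (by omega) (mr_all (k := k) m d (a+b) c hab)
  obtain ⟨y, hy⟩ := exists_drop hd C hC
  have hs := fun i => sundial_is (i1 i)
  refine ⟨fun i => Submodule.span k {C.1 (Fin.castAdd b i) 0, C.1 (Fin.castAdd b i) 1},
    fun i => Submodule.span k {C.1 (Fin.castAdd b i) 0, C.1 (Fin.castAdd b i) 2},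
    fun i => Submodule.span k (Set.range (C.1 (Fin.castAdd b i))),
    fun j => Submodule.span k {C.1 (Fin.natAdd a j) 0, C.1 (Fin.natAdd a j) 1},
    fun j => Submodule.span k {C.1 (Fin.natAdd a j) 0, C.1 (Fin.natAdd a j) 2},
    fun j => Submodule.span k {(y j).1},
    fun l => Submodule.span k {C.2 l 0, C.2 l 1},
    fun i => hs _, fun j => ⟨(hs _).1, (hs _).2.1, (hs _).2.2.1, (hs _).2.2.2.1⟩,
    fun j => finrank_span_singleton (y j).2, fun l => ?_, ?_⟩
  · have h2 := finrank_span_eq_card (i2 l)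
    have e : Set.range (C.2 l) = {C.2 l 0, C.2 l 1} := by
      ext z
      simp [Fin.exists_fin_two, eq_comm]
    rw [e, Fintype.card_fin] at h2
    exact h2
  · have hl := lower (d := d) C (fun j => (y j).1)
    have e0 : (2 * (a+b) + c) * (d+1) = (2*a+2*b+c)*(d+1) := by ring
    rw [e0] at hy
    have key : hdim k (m+4+1) ((⨅ i, sundialIdeal k (m+4+1) (Submodule.span k {C.1 (Fin.castAdd b i) 0, C.1 (Fin.castAdd b i) 1}) 
            (Submodule.span k {C.1 (Fin.castAdd b i) 0, C.1 (Fin.castAdd b i) 2}) 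
            (Submodule.span k (Set.range (C.1 (Fin.castAdd b i))))) ⊓
            (⨅ j, vanIdeal k (m+4+1) ↑(Submodule.span k {C.1 (Fin.natAdd a j) 0, C.1 (Fin.natAdd a j) 1}) ⊓ 
              vanIdeal k (m+4+1) ↑(Submodule.span k {C.1 (Fin.natAdd a j) 0, C.1 (Fin.natAdd a j) 2})) ⊓
            (⨅ j, vanIdeal k (m+4+1) ↑(Submodule.span k {(y j).1})) ⊓
            ⨅ l, vanIdeal k (m+4+1) ↑(Submodule.span k {C.2 l 0, C.2 l 1})) d = 
        Module.finrank k (kerOn (Id (Hm k (m+4+1) d) (Set.range (Fin.castAdd b)) C) (fun j => evL (y j).1)) := by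
      refine hdim_eq ((kerOn_le _ _).trans (Id_le _ _ _)) fun f hf => ?_
      rw [mem_kerOn, mem_Id]
      simp only [Ideal.mem_inf, Ideal.mem_iInf, mem_van_pair, mem_van_single hf, mem_sundial (i1 _) hf]
      constructor
      · rintro ⟨⟨⟨h1, h2⟩, h3⟩, h4⟩
        refine ⟨⟨hf, fun i => ?_, ?_, h4⟩, fun j => ?_⟩
        · exact Fin.addCases (fun i => (h1 i).1) (fun i => h2 i) i
        · rintro _ ⟨i, rfl⟩
          exact (h1 i).2
        · rw [evL_apply]; exact h3 j
      · rintro ⟨⟨-, h1, h2, h4⟩, h3⟩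
        refine ⟨⟨⟨fun i => ⟨h1 _, h2 _ ⟨i, rfl⟩⟩, fun j => h1 _⟩, fun j => ?_⟩, h4⟩
        simpa using h3 j
    rw [key]
    omega

end PartK
end S15

/-- Statements `S(n,d;a,b,c)` and `S*(n,d;a,b,c)` hold for all `n ≥ 4`: generic
sundials, degenerate conics, points and lines in `ℙ^n` impose the expected
number of conditions on forms of degree `d`. -/
theorem stmt15 (k : Type) [Field k] [IsAlgClosed k] [CharZero k]
    (n d a b c t ts : ℕ) (hn : 4 ≤ n) (hd : 1 ≤ d) (hab : a + b ≤ d - 1)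
    (ht : t = (d+n).choose n / (d+1)) (hts : ts = ((d+n).choose n + d) / (d+1)) :
    (c + 2*(a+b) ≤ t →
      ∃ (V₁ V₂ T : Fin a → Submodule k (Fin (n+1) → k))
        (D₁ D₂ : Fin b → Submodule k (Fin (n+1) → k))
        (R : Fin b → Submodule k (Fin (n+1) → k))
        (M : Fin c → Submodule k (Fin (n+1) → k)),
        (∀ i, IsSundial k (n+1) (V₁ i) (V₂ i) (T i)) ∧
        (∀ j, Module.finrank k (D₁ j) = 2 ∧ Module.finrank k (D₂ j) = 2 ∧
          D₁ j ≠ D₂ j ∧ Module.finrank k ↥(D₁ j ⊓ D₂ j) = 1) ∧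
        (∀ j, Module.finrank k (R j) = 1) ∧
        (∀ l, Module.finrank k (M l) = 2) ∧
        (hdim k (n+1) ((⨅ i, sundialIdeal k (n+1) (V₁ i) (V₂ i) (T i)) ⊓
            (⨅ j, vanIdeal k (n+1) ↑(D₁ j) ⊓ vanIdeal k (n+1) ↑(D₂ j)) ⊓
            (⨅ j, vanIdeal k (n+1) ↑(R j)) ⊓
            ⨅ l, vanIdeal k (n+1) ↑(M l)) d : ℤ)
          = ((d+n).choose n : ℤ) - (2*a + 2*b + c) * (d+1)) ∧
    (ts ≤ c + 2*(a+b) →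
      ∃ (V₁ V₂ T : Fin a → Submodule k (Fin (n+1) → k))
        (D₁ D₂ : Fin b → Submodule k (Fin (n+1) → k))
        (R : Fin b → Submodule k (Fin (n+1) → k))
        (M : Fin c → Submodule k (Fin (n+1) → k)),
        (∀ i, IsSundial k (n+1) (V₁ i) (V₂ i) (T i)) ∧
        (∀ j, Module.finrank k (D₁ j) = 2 ∧ Module.finrank k (D₂ j) = 2 ∧
          D₁ j ≠ D₂ j ∧ Module.finrank k ↥(D₁ j ⊓ D₂ j) = 1) ∧
        (∀ j, Module.finrank k (R j) = 1) ∧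
        (∀ l, Module.finrank k (M l) = 2) ∧
        hdim k (n+1) ((⨅ i, sundialIdeal k (n+1) (V₁ i) (V₂ i) (T i)) ⊓
          (⨅ j, vanIdeal k (n+1) ↑(D₁ j) ⊓ vanIdeal k (n+1) ↑(D₂ j)) ⊓
          (⨅ j, vanIdeal k (n+1) ↑(R j)) ⊓
          ⨅ l, vanIdeal k (n+1) ↑(M l)) d = 0) := by
  constructor
  · intro h
    obtain ⟨V₁, V₂, T, D₁, D₂, R, M, h1, h2, h3, h4, h5⟩ := S15.main_exists (k := k) n d a b c hn hd hab
    refine ⟨V₁, V₂, T, D₁, D₂, R, M, h1, h2, h3, h4, ?_⟩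
    rw [h5]
    have hle : (2*a+2*b+c)*(d+1) ≤ (d+n).choose n := by
      have e : 2*a+2*b+c ≤ (d+n).choose n / (d+1) := by omega
      exact (Nat.mul_le_mul_right _ e).trans (Nat.div_mul_le_self _ _)
    rw [Nat.cast_sub hle]
    push_cast
    ring
  · intro h
    obtain ⟨V₁, V₂, T, D₁, D₂, R, M, h1, h2, h3, h4, h5⟩ := S15.main_exists (k := k) n d a b c hn hd hab
    refine ⟨V₁, V₂, T, D₁, D₂, R, M, h1, h2, h3, h4, ?_⟩
    rw [h5]
    have hge : (d+n).choose n ≤ (2*a+2*b+c)*(d+1) := by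
      have e : ((d+n).choose n + d) / (d+1) < 2*a+2*b+c + 1 := by omega
      have e2 := Nat.lt_mul_of_div_lt e (by omega : 0 < d + 1)
      rw [add_mul, one_mul] at e2
      omega
    exact Nat.sub_eq_zero_of_le hge
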